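/- arXiv:0811.3787 — 7 statements merged into one kernel-verified Lean document; each statement's English description precedes it below -/
import Mathlib

section
/- With G, d, T, gᵢ and the notion of 3-word as in the context, for every s ≥ 1 the 𝔽₃-subspace of G spanned by all 3-words in which each of the letters g₀, g₁, g₂ occurs exactly once and each of the letters g₃, g₄, …, g_{s+2} occurs exactly twice has 𝔽₃-dimension 1. -/
/-- The Grassmann (exterior) algebra over `𝔽₃` of the free module with basis
indexed by `ℕ × ℕ`. -/
abbrev Gr : Type := ExteriorAlgebra (ZMod 3) ((ℕ × ℕ) →₀ ZMod 3)

/-- The generator `i^{(j)}` of the Grassmann algebra, i.e. `ι(e_{i,j})`. -/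
noncomputable abbrev gen (i j : ℕ) : Gr :=
  ExteriorAlgebra.ι (ZMod 3) (Finsupp.single (i, j) (1 : ZMod 3))

/-- `gᵢ = ι(e_{i,0})`. -/
noncomputable abbrev g (i : ℕ) : Gr := gen i 0

/-- `IsWord3 g T x L` : `x` is a 3-word, for the ternary operation `T`, in the
multiset of letters `L` (a multiset of indices of the generators `g`). Each
`g i` is a 3-word in the singleton multiset `{i}`, and if `u, v, w` are 3-words
in `L₁, L₂, L₃` then `T u v w` is a 3-word in `L₁ + L₂ + L₃`. -/
inductive IsWord3 {G : Type*} (g : ℕ → G) (T : G → G → G → G) : G → Multiset ℕ → Prop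
  | letter (i : ℕ) : IsWord3 g T (g i) {i}
  | node {u v w : G} {L₁ L₂ L₃ : Multiset ℕ} :
      IsWord3 g T u L₁ → IsWord3 g T v L₂ → IsWord3 g T w L₃ →
      IsWord3 g T (T u v w) (L₁ + L₂ + L₃)

open ExteriorAlgebra

/-- The monomial in the Grassmann algebra attached to a list of indices of generators. -/
noncomputable def monomial (l : List (ℕ × ℕ)) : Gr := (l.map fun p => gen p.1 p.2).prod

@[simp] lemma monomial_nil : monomial [] = 1 := rfl

@[simp] lemma monomial_cons (p : ℕ × ℕ) (l : List (ℕ × ℕ)) :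
    monomial (p :: l) = gen p.1 p.2 * monomial l := by
  simp [monomial]

@[simp] lemma monomial_append (l l' : List (ℕ × ℕ)) :
    monomial (l ++ l') = monomial l * monomial l' := by
  simp [monomial]

lemma gen_mul_self (i j : ℕ) : gen i j * gen i j = 0 :=
  ι_sq_zero _

lemma gen_mul_self_mul (i j : ℕ) (x : Gr) : gen i j * (gen i j * x) = 0 := by
  rw [← mul_assoc, gen_mul_self, zero_mul]

lemma gen_mul_swap (p q : ℕ × ℕ) : gen p.1 p.2 * gen q.1 q.2 = -(gen q.1 q.2 * gen p.1 p.2) :=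
  eq_neg_of_add_eq_zero_left (ι_add_mul_swap _ _)

lemma monomial_perm {l l' : List (ℕ × ℕ)} (h : l.Perm l') :
    monomial l = monomial l' ∨ monomial l = -monomial l' := by
  induction h with
  | nil => simp
  | cons p _ ih => rcases ih with ih | ih <;> simp [ih]
  | swap p q l =>
    right
    simp only [monomial_cons, ← mul_assoc]
    rw [gen_mul_swap q p, neg_mul]
  | trans _ _ ih ih' => rcases ih with ih | ih <;> rcases ih' with ih' | ih' <;> simp [ih, ih']

lemma monomial_eq_zero_of_not_nodup {l : List (ℕ × ℕ)} (h : ¬ l.Nodup) : monomial l = 0 := by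
  rw [← List.exists_duplicate_iff_not_nodup] at h
  obtain ⟨p, hp⟩ := h
  obtain ⟨t, ht⟩ := (List.duplicate_iff_sublist.mp hp).exists_perm_append
  rcases monomial_perm ht with h | h <;> simp [h, gen_mul_self_mul]

lemma contractLeft_monomial_of_notMem {p : ℕ × ℕ} {l : List (ℕ × ℕ)} (h : p ∉ l) :
    CliffordAlgebra.contractLeft (Q := (0 : QuadraticForm (ZMod 3) ((ℕ × ℕ) →₀ ZMod 3)))
      (Finsupp.lapply p) (monomial l) = 0 := by
  induction l with
  | nil => exact CliffordAlgebra.contractLeft_one (Q := 0) _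
  | cons q l ih =>
    rw [List.mem_cons, not_or] at h
    rw [monomial_cons]
    refine (CliffordAlgebra.contractLeft_ι_mul _ _ _).trans ?_
    rw [ih h.2]
    simp [Ne.symm h.1]

lemma monomial_ne_zero {l : List (ℕ × ℕ)} (h : l.Nodup) : monomial l ≠ 0 := by
  induction l with
  | nil => simp
  | cons p l ih =>
    rw [List.nodup_cons] at h
    intro h0
    apply ih h.2
    have key := CliffordAlgebra.contractLeft_ι_mul
      (Q := (0 : QuadraticForm (ZMod 3) ((ℕ × ℕ) →₀ ZMod 3)))
      (Finsupp.single p 1) (monomial l) (d := Finsupp.lapply p)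
    rw [contractLeft_monomial_of_notMem h.1] at key
    have h1 : CliffordAlgebra.ι (0 : QuadraticForm (ZMod 3) ((ℕ × ℕ) →₀ ZMod 3))
        (Finsupp.single p 1) * monomial l = 0 := (monomial_cons p l).symm.trans h0
    rw [h1] at key
    simpa using key.symm

/-- The span of the monomials with multiset of letters `L` and total order of derivation `w`. -/
noncomputable def weightSpace (L : Multiset ℕ) (w : ℕ) : Submodule (ZMod 3) Gr :=
  Submodule.span (ZMod 3)
    {x | ∃ l : List (ℕ × ℕ), (l : Multiset (ℕ × ℕ)).map Prod.fst = L ∧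
      ((l : Multiset (ℕ × ℕ)).map Prod.snd).sum = w ∧ monomial l = x}

lemma monomial_mem_weightSpace (l : List (ℕ × ℕ)) :
    monomial l ∈ weightSpace ((l : Multiset (ℕ × ℕ)).map Prod.fst)
      ((l : Multiset (ℕ × ℕ)).map Prod.snd).sum :=
  Submodule.subset_span ⟨l, rfl, rfl, rfl⟩

lemma gen_mem_weightSpace (i j : ℕ) : gen i j ∈ weightSpace {i} j := by
  simpa using monomial_mem_weightSpace [(i, j)]

lemma mul_mem_weightSpace {L L' : Multiset ℕ} {w w' : ℕ} {x y : Gr}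
    (hx : x ∈ weightSpace L w) (hy : y ∈ weightSpace L' w') :
    x * y ∈ weightSpace (L + L') (w + w') := by
  have h := Submodule.mul_mem_mul hx hy
  rw [weightSpace, weightSpace, Submodule.span_mul_span] at h
  refine Submodule.span_mono ?_ h
  rintro _ ⟨_, ⟨l, rfl, rfl, rfl⟩, _, ⟨l', rfl, rfl, rfl⟩, rfl⟩
  refine ⟨l ++ l', ?_, ?_, monomial_append l l'⟩
  · rw [← Multiset.coe_add, Multiset.map_add]
  · rw [← Multiset.coe_add, Multiset.map_add, Multiset.sum_add]

lemma deriv_monomial_mem_weightSpace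
    {d : Gr →ₗ[ZMod 3] Gr} (hLeib : ∀ u v : Gr, d (u * v) = d u * v + u * d v)
    (hd : ∀ i j : ℕ, d (gen i j) = gen i (j + 1))
    (l : List (ℕ × ℕ)) :
    d (monomial l) ∈ weightSpace ((l : Multiset (ℕ × ℕ)).map Prod.fst)
      (((l : Multiset (ℕ × ℕ)).map Prod.snd).sum + 1) := by
  induction l with
  | nil =>
    have h : d 1 = 0 := by simpa using hLeib 1 1
    simp [h]
  | cons p l ih =>
    rw [monomial_cons, hLeib, hd, ← Multiset.cons_coe, Multiset.map_cons, Multiset.map_cons,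
      Multiset.sum_cons, ← Multiset.singleton_add]
    refine add_mem ?_ ?_
    · have := mul_mem_weightSpace (gen_mem_weightSpace p.1 (p.2 + 1)) (monomial_mem_weightSpace l)
      rwa [add_right_comm] at this
    · have := mul_mem_weightSpace (gen_mem_weightSpace p.1 p.2) ih
      rwa [← add_assoc] at this

lemma deriv_mem_weightSpace
    {d : Gr →ₗ[ZMod 3] Gr} (hLeib : ∀ u v : Gr, d (u * v) = d u * v + u * d v)
    (hd : ∀ i j : ℕ, d (gen i j) = gen i (j + 1))
    {L : Multiset ℕ} {w : ℕ} {x : Gr} (hx : x ∈ weightSpace L w) :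
    d x ∈ weightSpace L (w + 1) := by
  refine (Submodule.span_le (p := (weightSpace L (w + 1)).comap d)).mpr ?_ hx
  rintro _ ⟨l, rfl, rfl, rfl⟩
  exact deriv_monomial_mem_weightSpace hLeib hd l

lemma IsWord3.exists_mem_weightSpace
    {d : Gr →ₗ[ZMod 3] Gr} (hLeib : ∀ u v : Gr, d (u * v) = d u * v + u * d v)
    (hd : ∀ i j : ℕ, d (gen i j) = gen i (j + 1))
    {x : Gr} {L : Multiset ℕ}
    (h : IsWord3 g (fun a b c => -d (a * b * c)) x L) :
    ∃ w, L.card = 2 * w + 1 ∧ x ∈ weightSpace L w := by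
  induction h with
  | letter i => exact ⟨0, by simp, gen_mem_weightSpace i 0⟩
  | node _ _ _ ih₁ ih₂ ih₃ =>
    obtain ⟨w₁, hc₁, h₁⟩ := ih₁
    obtain ⟨w₂, hc₂, h₂⟩ := ih₂
    obtain ⟨w₃, hc₃, h₃⟩ := ih₃
    refine ⟨w₁ + w₂ + w₃ + 1, ?_, neg_mem (deriv_mem_weightSpace hLeib hd
      (mul_mem_weightSpace (mul_mem_weightSpace h₁ h₂) h₃))⟩
    simp only [Multiset.card_add]
    omega

/-- The letters `0, 1, 2` once each and `3, …, s + 2` twice each. -/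
def letters (s : ℕ) : Multiset ℕ :=
  ({0, 1, 2} : Multiset ℕ) + 2 • Multiset.map (· + 3) (Multiset.range s)

lemma letters_succ (s : ℕ) : letters (s + 1) = (s + 3) ::ₘ (s + 3) ::ₘ letters s := by
  simp only [letters, Multiset.range_succ, Multiset.map_cons, two_nsmul, Multiset.cons_add,
    Multiset.add_cons]

lemma card_letters (s : ℕ) : (letters s).card = 2 * s + 3 := by
  simp only [letters, Multiset.card_add, Multiset.card_nsmul, Multiset.card_map,
    Multiset.card_range]
  exact add_comm _ _

/-- The indices of the generators in the monomial
`g₀ g₁ (g₃' g₃) ⋯ (g_{s+2}' g_{s+2})`. -/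
def pairedIndices : ℕ → List (ℕ × ℕ)
  | 0 => [(0, 0), (1, 0)]
  | s + 1 => pairedIndices s ++ [(s + 3, 1), (s + 3, 0)]

/-- The indices of the generators in the only monomial of weight `s` in `letters s`. -/
def minimalIndices (s : ℕ) : List (ℕ × ℕ) := pairedIndices s ++ [(2, 0)]

lemma coe_minimalIndices_succ (s : ℕ) : (minimalIndices (s + 1) : Multiset (ℕ × ℕ)) =
    (s + 3, 1) ::ₘ (s + 3, 0) ::ₘ (minimalIndices s : Multiset (ℕ × ℕ)) := by
  simp only [minimalIndices, pairedIndices, ← Multiset.coe_add]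
  rw [add_right_comm, add_comm]
  rfl

lemma sum_snd_minimalIndices (s : ℕ) :
    ((minimalIndices s : Multiset (ℕ × ℕ)).map Prod.snd).sum = s := by
  induction s with
  | zero => rfl
  | succ s ih =>
    rw [coe_minimalIndices_succ]
    simp only [Multiset.map_cons, Multiset.sum_cons, ih]
    omega

lemma fst_lt_of_mem_minimalIndices {s : ℕ} {p : ℕ × ℕ} (hp : p ∈ minimalIndices s) :
    p.1 < s + 3 := by
  induction s with
  | zero =>
    simp only [minimalIndices, pairedIndices, List.cons_append, List.nil_append, List.mem_cons,
      List.not_mem_nil, or_false] at hp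
    rcases hp with rfl | rfl | rfl <;> decide
  | succ s ih =>
    rw [← Multiset.mem_coe, coe_minimalIndices_succ, Multiset.mem_cons, Multiset.mem_cons,
      Multiset.mem_coe] at hp
    rcases hp with rfl | rfl | hp
    · simp
    · simp
    · have := ih hp
      omega

lemma zero_one_notMem_minimalIndices (s : ℕ) : (0, 1) ∉ minimalIndices s := by
  induction s with
  | zero => decide
  | succ s ih =>
    rw [← Multiset.mem_coe, coe_minimalIndices_succ]
    simpa using ih

lemma exists_minimalIndices_eq_cons (s : ℕ) : ∃ l, minimalIndices s = (0, 0) :: l := by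
  suffices h : ∃ l, pairedIndices s = (0, 0) :: l by
    obtain ⟨l, hl⟩ := h
    exact ⟨l ++ [(2, 0)], by rw [minimalIndices, hl, List.cons_append]⟩
  induction s with
  | zero => exact ⟨_, rfl⟩
  | succ s ih =>
    obtain ⟨l, hl⟩ := ih
    exact ⟨l ++ [(s + 3, 1), (s + 3, 0)], by rw [pairedIndices, hl, List.cons_append]⟩

lemma nodup_minimalIndices (s : ℕ) : (minimalIndices s).Nodup := by
  induction s with
  | zero => decide
  | succ s ih =>
    have h (j : ℕ) : (s + 3, j) ∉ minimalIndices s := fun hj =>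
      (fst_lt_of_mem_minimalIndices hj).ne rfl
    rw [← Multiset.coe_nodup, coe_minimalIndices_succ]
    simp [h, ih]

lemma eq_minimalIndices {s : ℕ} {S : Multiset (ℕ × ℕ)} (hS : S.Nodup)
    (hL : S.map Prod.fst = letters s) (hw : (S.map Prod.snd).sum ≤ s) :
    S = (minimalIndices s : Multiset (ℕ × ℕ)) := by
  induction s generalizing S with
  | zero =>
    have hz : ∀ p ∈ S, p = (p.1, 0) := by
      intro p hp
      have : p.2 ≤ (S.map Prod.snd).sum :=
        Multiset.single_le_sum (fun _ _ => Nat.zero_le _) _ (Multiset.mem_map_of_mem _ hp)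
      exact Prod.ext rfl (by simp; omega)
    calc S = (S.map Prod.fst).map (fun i => (i, 0)) := by
          rw [Multiset.map_map]
          conv_lhs => rw [← Multiset.map_id S]
          exact Multiset.map_congr rfl hz
      _ = _ := by
          rw [hL]
          decide
  | succ s ih =>
    rw [letters_succ] at hL
    obtain ⟨p, hp, hp₁, hT⟩ := (Multiset.map_eq_cons _ _ _ _).mpr hL
    obtain ⟨T, rfl⟩ := Multiset.exists_cons_of_mem hp
    rw [Multiset.erase_cons_head] at hT
    obtain ⟨q, hq, hq₁, hUL⟩ := (Multiset.map_eq_cons _ _ _ _).mpr hT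
    obtain ⟨U, rfl⟩ := Multiset.exists_cons_of_mem hq
    rw [Multiset.erase_cons_head] at hUL
    obtain ⟨i, a⟩ := p
    obtain ⟨j, b⟩ := q
    obtain rfl : i = s + 3 := hp₁
    obtain rfl : j = s + 3 := hq₁
    simp only [Multiset.nodup_cons, Multiset.mem_cons, not_or, Prod.mk.injEq, true_and] at hS
    obtain ⟨⟨hab, -⟩, -, hU⟩ := hS
    simp only [Multiset.map_cons, Multiset.sum_cons] at hw
    have hUs := ih hU hUL (by omega)
    rw [coe_minimalIndices_succ, hUs]
    rw [hUs, sum_snd_minimalIndices] at hw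
    obtain ⟨rfl, rfl⟩ | ⟨rfl, rfl⟩ : (a = 1 ∧ b = 0) ∨ (a = 0 ∧ b = 1) := by omega
    · rfl
    · exact Multiset.cons_swap _ _ _

lemma weightSpace_letters_le (s : ℕ) :
    weightSpace (letters s) s ≤ Submodule.span (ZMod 3) {monomial (minimalIndices s)} := by
  refine Submodule.span_le.mpr ?_
  rintro _ ⟨l, hL, hw, rfl⟩
  by_cases hl : l.Nodup
  · have hp : l.Perm (minimalIndices s) :=
      Multiset.coe_eq_coe.mp (eq_minimalIndices (Multiset.coe_nodup.mpr hl) hL hw.le)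
    have hm := Submodule.mem_span_singleton_self (R := ZMod 3) (monomial (minimalIndices s))
    rcases monomial_perm hp with h | h
    · exact h ▸ hm
    · exact h ▸ neg_mem hm
  · rw [monomial_eq_zero_of_not_nodup hl]
    exact zero_mem _

lemma IsWord3.mem_span_deriv_monomial
    {d : Gr →ₗ[ZMod 3] Gr} (hLeib : ∀ u v : Gr, d (u * v) = d u * v + u * d v)
    (hd : ∀ i j : ℕ, d (gen i j) = gen i (j + 1))
    {x : Gr} {s : ℕ}
    (h : IsWord3 g (fun a b c => -d (a * b * c)) x (letters s)) :
    x ∈ Submodule.span (ZMod 3) {d (monomial (minimalIndices s))} := by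
  have hcard := card_letters s
  generalize hL : letters s = L at h hcard
  cases h with
  | letter i => simp at hcard
  | node h₁ h₂ h₃ =>
    obtain ⟨w₁, hc₁, h₁⟩ := h₁.exists_mem_weightSpace hLeib hd
    obtain ⟨w₂, hc₂, h₂⟩ := h₂.exists_mem_weightSpace hLeib hd
    obtain ⟨w₃, hc₃, h₃⟩ := h₃.exists_mem_weightSpace hLeib hd
    have hm := mul_mem_weightSpace (mul_mem_weightSpace h₁ h₂) h₃
    simp only [Multiset.card_add] at hcard
    rw [← hL, show w₁ + w₂ + w₃ = s by omega] at hm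
    obtain ⟨c, hc⟩ := Submodule.mem_span_singleton.mp (weightSpace_letters_le s hm)
    refine neg_mem (Submodule.mem_span_singleton.mpr ⟨c, ?_⟩)
    rw [← hc, map_smul]

/-- For every letter `i` there is a word whose outermost operation is applied to
`± g₀ g₁ (g₃' g₃) ⋯ (g_{s+2}' g_{s+2}) gᵢ`. -/
lemma exists_isWord3_deriv_monomial
    {d : Gr →ₗ[ZMod 3] Gr} (hLeib : ∀ u v : Gr, d (u * v) = d u * v + u * d v)
    (hd : ∀ i j : ℕ, d (gen i j) = gen i (j + 1))
    (s i : ℕ) :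
    ∃ x L, IsWord3 g (fun a b c => -d (a * b * c)) x L ∧ 2 ::ₘ L = i ::ₘ letters s ∧
      (x = d (monomial (pairedIndices s ++ [(i, 0)])) ∨
        x = -d (monomial (pairedIndices s ++ [(i, 0)]))) := by
  induction s generalizing i with
  | zero =>
    refine ⟨_, _, .node (.letter 0) (.letter 1) (.letter i), ?_, .inr ?_⟩
    · ext n
      simp [letters, Multiset.count_cons, Multiset.count_singleton]
      ring
    · simp [pairedIndices, mul_assoc]
  | succ s ih =>
    obtain ⟨x, L, hx, hL, h⟩ := ih (s + 3)
    refine ⟨_, _, .node hx (.letter (s + 3)) (.letter i), ?_, ?_⟩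
    · rw [letters_succ, Multiset.add_comm (L + _), Multiset.add_comm L, Multiset.singleton_add,
        Multiset.singleton_add, Multiset.cons_swap 2, Multiset.cons_swap 2, hL]
    · have key : d (monomial (pairedIndices s ++ [(s + 3, 0)])) * g (s + 3) * g i =
          monomial (pairedIndices (s + 1) ++ [(i, 0)]) := by
        simp [pairedIndices, hLeib, hd, add_mul, mul_assoc]
      rcases h with rfl | rfl
      · exact .inr (by rw [key])
      · exact .inl (by simp only [neg_mul, key, map_neg, neg_neg])

lemma deriv_monomial_minimalIndices_ne_zero
    {d : Gr →ₗ[ZMod 3] Gr} (hLeib : ∀ u v : Gr, d (u * v) = d u * v + u * d v)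
    (hd : ∀ i j : ℕ, d (gen i j) = gen i (j + 1))
    (s : ℕ) : d (monomial (minimalIndices s)) ≠ 0 := by
  have hn := nodup_minimalIndices s
  have h01 := zero_one_notMem_minimalIndices s
  obtain ⟨l, hl⟩ := exists_minimalIndices_eq_cons s
  rw [hl] at hn h01 ⊢
  rw [List.nodup_cons] at hn
  rw [List.mem_cons, not_or] at h01
  intro h
  have hne : monomial ((0, 0) :: (0, 1) :: l) ≠ 0 :=
    monomial_ne_zero (by simp [hn.1, hn.2, h01.2])
  apply hne
  rw [monomial_cons, hLeib, hd] at h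
  simpa [mul_add, gen_mul_self_mul] using congrArg (gen 0 0 * ·) h

/-- the `𝔽₃`-span of all 3-words in the letters g₀,g₁,g₂ (once each) and g₃,…,g_{s+2} (twice each)
has dimension `1`. -/
theorem stmt_6 (d : Gr →ₗ[ZMod 3] Gr)
    (hLeib : ∀ u v : Gr, d (u * v) = d u * v + u * d v)
    (hd : ∀ i j : ℕ, d (gen i j) = gen i (j + 1))
    (s : ℕ) (hs : 1 ≤ s) :
    Module.finrank (ZMod 3)
      ↥(Submodule.span (ZMod 3)
        {x : Gr | IsWord3 g (fun a b c => -d (a * b * c)) x (({0, 1, 2} : Multiset ℕ) + 2 • Multiset.map (· + 3) (Multiset.range s))}) = 1 := by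
  suffices h : Submodule.span (ZMod 3)
      {x : Gr | IsWord3 g (fun a b c => -d (a * b * c)) x (letters s)} =
      Submodule.span (ZMod 3) {d (monomial (minimalIndices s))} by
    change Module.finrank (ZMod 3) ↥(Submodule.span (ZMod 3)
      {x : Gr | IsWord3 g (fun a b c => -d (a * b * c)) x (letters s)}) = 1
    rw [h]
    exact finrank_span_singleton (deriv_monomial_minimalIndices_ne_zero hLeib hd s)
  refine le_antisymm (Submodule.span_le.mpr fun x hx => hx.mem_span_deriv_monomial hLeib hd) ?_
  rw [Submodule.span_singleton_le_iff_mem]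
  obtain ⟨x, L, hx, hL, h⟩ := exists_isWord3_deriv_monomial hLeib hd s 2
  rw [Multiset.cons_inj_right] at hL
  subst hL
  have hm := Submodule.subset_span (R := ZMod 3)
    (s := {x : Gr | IsWord3 g (fun a b c => -d (a * b * c)) x (letters s)}) hx
  rcases h with rfl | rfl
  · exact hm
  · exact neg_mem_iff.mp hm
end

section
/- With G, d, T, gᵢ and the notion of 3-word as in the context, the 𝔽₃-subspace of G spanned by all 3-words in which each of the letters g₀, g₁, g₂, g₃, g₄ occurs exactly once has 𝔽₃-dimension 4. -/
/-! ### Shape of 3-words with at most five letters -/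

namespace IsWord3

variable {G : Type*} {g : ℕ → G} {T : G → G → G → G} {x : G} {L : Multiset ℕ}

lemma odd_card (h : IsWord3 g T x L) : Odd L.card := by
  induction h with
  | letter i => simp
  | node _ _ _ h₁ h₂ h₃ =>
    simp only [Multiset.card_add]
    exact (h₁.add_odd h₂).add_odd h₃

lemma exists_of_card_eq_one (h : IsWord3 g T x L) (hL : L.card = 1) :
    ∃ a, x = g a ∧ L = {a} := by
  cases h with
  | letter i => exact ⟨i, rfl, rfl⟩
  | node h₁ h₂ h₃ =>
    have := h₁.odd_card.pos
    have := h₂.odd_card.pos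
    simp only [Multiset.card_add] at hL
    omega

lemma exists_of_card_eq_three (h : IsWord3 g T x L) (hL : L.card = 3) :
    ∃ a b c, x = T (g a) (g b) (g c) ∧ L = {a, b, c} := by
  cases h with
  | letter i => simp at hL
  | node h₁ h₂ h₃ =>
    have := h₁.odd_card.pos
    have := h₂.odd_card.pos
    have := h₃.odd_card.pos
    simp only [Multiset.card_add] at hL
    obtain ⟨a, rfl, rfl⟩ := h₁.exists_of_card_eq_one (by omega)
    obtain ⟨b, rfl, rfl⟩ := h₂.exists_of_card_eq_one (by omega)
    obtain ⟨c, rfl, rfl⟩ := h₃.exists_of_card_eq_one (by omega)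
    exact ⟨a, b, c, rfl, rfl⟩

lemma exists_of_card_eq_five (h : IsWord3 g T x L) (hL : L.card = 5) :
    ∃ p : Fin 5 → ℕ, L = Multiset.map p Finset.univ.val ∧
      (x = T (T (g (p 0)) (g (p 1)) (g (p 2))) (g (p 3)) (g (p 4)) ∨
        x = T (g (p 0)) (T (g (p 1)) (g (p 2)) (g (p 3))) (g (p 4)) ∨
        x = T (g (p 0)) (g (p 1)) (T (g (p 2)) (g (p 3)) (g (p 4)))) := by
  cases h with
  | letter i => simp at hL
  | @node u v w L₁ L₂ L₃ h₁ h₂ h₃ =>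
    obtain ⟨k₁, hk₁⟩ := h₁.odd_card
    obtain ⟨k₂, hk₂⟩ := h₂.odd_card
    obtain ⟨k₃, hk₃⟩ := h₃.odd_card
    simp only [Multiset.card_add] at hL
    have key : (L₁.card = 3 ∧ L₂.card = 1 ∧ L₃.card = 1) ∨
        (L₁.card = 1 ∧ L₂.card = 3 ∧ L₃.card = 1) ∨
        (L₁.card = 1 ∧ L₂.card = 1 ∧ L₃.card = 3) := by omega
    rcases key with ⟨c₁, c₂, c₃⟩ | ⟨c₁, c₂, c₃⟩ | ⟨c₁, c₂, c₃⟩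
    · obtain ⟨a, b, c, rfl, rfl⟩ := h₁.exists_of_card_eq_three c₁
      obtain ⟨e, rfl, rfl⟩ := h₂.exists_of_card_eq_one c₂
      obtain ⟨f, rfl, rfl⟩ := h₃.exists_of_card_eq_one c₃
      exact ⟨![a, b, c, e, f], rfl, Or.inl rfl⟩
    · obtain ⟨a, rfl, rfl⟩ := h₁.exists_of_card_eq_one c₁
      obtain ⟨b, c, e, rfl, rfl⟩ := h₂.exists_of_card_eq_three c₂
      obtain ⟨f, rfl, rfl⟩ := h₃.exists_of_card_eq_one c₃
      exact ⟨![a, b, c, e, f], rfl, Or.inr (Or.inl rfl)⟩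
    · obtain ⟨a, rfl, rfl⟩ := h₁.exists_of_card_eq_one c₁
      obtain ⟨b, rfl, rfl⟩ := h₂.exists_of_card_eq_one c₂
      obtain ⟨c, e, f, rfl, rfl⟩ := h₃.exists_of_card_eq_three c₃
      exact ⟨![a, b, c, e, f], rfl, Or.inr (Or.inr rfl)⟩

end IsWord3

lemma exists_perm_of_map_univ_eq {p : Fin 5 → ℕ}
    (hp : ({0, 1, 2, 3, 4} : Multiset ℕ) = Multiset.map p Finset.univ.val) :
    ∃ σ : Equiv.Perm (Fin 5), ∀ l, p l = σ l := by
  have hlt : ∀ l, p l < 5 := fun l => by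
    have : p l ∈ ({0, 1, 2, 3, 4} : Multiset ℕ) :=
      hp ▸ Multiset.mem_map_of_mem p (Finset.mem_univ l)
    simp only [Multiset.insert_eq_cons, Multiset.mem_cons, Multiset.mem_singleton] at this
    omega
  have hnodup : (Multiset.map p Finset.univ.val).Nodup := hp ▸ by decide
  have hinj : Function.Injective p := fun a b hab =>
    Multiset.inj_on_of_nodup_map hnodup a (Finset.mem_univ a) b (Finset.mem_univ b) hab
  refine ⟨Equiv.ofBijective (fun l => (⟨p l, hlt l⟩ : Fin 5))
    (Finite.injective_iff_bijective.mp fun a b hab => hinj ?_), fun l => rfl⟩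
  simpa using hab

/-! ### Monomials in the derivatives of the five letters -/

/-- The monomial `0^{(e 0)} 1^{(e 1)} ⋯ 4^{(e 4)}`. -/
noncomputable def letterMonomial (e : Fin 5 → ℕ) : Gr :=
  ExteriorAlgebra.ιMulti (ZMod 3) 5 fun l => Finsupp.single ((l : ℕ), e l) 1

lemma letterMonomial_eq_mul (e : Fin 5 → ℕ) :
    letterMonomial e = gen 0 (e 0) * gen 1 (e 1) * gen 2 (e 2) * gen 3 (e 3) * gen 4 (e 4) := by
  simp [letterMonomial, ExteriorAlgebra.ιMulti_apply, mul_assoc]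
  rfl

lemma gen_perm_mul (σ : Equiv.Perm (Fin 5)) (e : Fin 5 → ℕ) :
    gen (σ 0) (e (σ 0)) * gen (σ 1) (e (σ 1)) * gen (σ 2) (e (σ 2)) * gen (σ 3) (e (σ 3)) *
      gen (σ 4) (e (σ 4)) = Equiv.Perm.sign σ • letterMonomial e := by
  rw [letterMonomial, ← AlternatingMap.map_perm]
  simp [ExteriorAlgebra.ιMulti_apply, mul_assoc]
  rfl

/-- Projection onto the coordinates `(l, e l)`. -/
noncomputable def letterCoords (e : Fin 5 → ℕ) : ((ℕ × ℕ) →₀ ZMod 3) →ₗ[ZMod 3] (Fin 5 → ZMod 3) :=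
  LinearMap.pi fun l => Finsupp.lapply ((l : ℕ), e l)

/-- The coefficient of `letterMonomial e`. -/
noncomputable def letterCoeff (e : Fin 5 → ℕ) : Gr →ₗ[ZMod 3] ZMod 3 :=
  ExteriorAlgebra.liftAlternating
    (Pi.single 5 (Matrix.detRowAlternating.compLinearMap (letterCoords e)))

lemma letterCoeff_letterMonomial (e e' : Fin 5 → ℕ) :
    letterCoeff e (letterMonomial e') = if e' = e then 1 else 0 := by
  have hdiag : (fun l : Fin 5 => letterCoords e (Finsupp.single ((l : ℕ), e' l) 1)) =
      Matrix.diagonal fun l => if e' l = e l then (1 : ZMod 3) else 0 := by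
    ext l k
    by_cases hlk : l = k
    · subst hlk
      simp [letterCoords, Finsupp.single_apply]
    · simp [letterCoords, hlk, Fin.val_inj]
  rw [letterCoeff, letterMonomial, ExteriorAlgebra.liftAlternating_apply_ιMulti, Pi.single_eq_same,
    AlternatingMap.compLinearMap_apply, hdiag]
  have hdet := Matrix.det_diagonal (d := fun l => if e' l = e l then (1 : ZMod 3) else 0)
  rw [Matrix.det] at hdet
  rw [hdet, Finset.prod_ite_zero]
  simp [funext_iff]

/-! ### The image of the sum-zero hyperplane -/

/-- The functional `c ↦ ∑ i, c i` on `𝔽₃⁵`. -/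
def coordSum : (Fin 5 → ZMod 3) →ₗ[ZMod 3] ZMod 3 := ∑ i, LinearMap.proj i

lemma finrank_ker_coordSum : Module.finrank (ZMod 3) (LinearMap.ker coordSum) = 4 := by
  have hsurj : LinearMap.range coordSum = ⊤ :=
    LinearMap.range_eq_top.mpr fun c => ⟨Pi.single 0 c, by simp [coordSum]⟩
  have := LinearMap.finrank_range_add_finrank_ker coordSum
  rw [hsurj, finrank_top, Module.finrank_self, Module.finrank_fin_fun] at this
  omega

/-- The map `c ↦ d (∑ i, c i • (0 1 ⋯ i^{(1)} ⋯ 4))`. -/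
noncomputable def derivCombination (d : Gr →ₗ[ZMod 3] Gr) : (Fin 5 → ZMod 3) →ₗ[ZMod 3] Gr :=
  d ∘ₗ Fintype.linearCombination (ZMod 3) fun i => letterMonomial (Pi.single i 1)

section

variable {d : Gr →ₗ[ZMod 3] Gr}

lemma derivCombination_single (i : Fin 5) :
    derivCombination d (Pi.single i 1) = d (letterMonomial (Pi.single i 1)) := by
  simp [derivCombination, Fintype.linearCombination_apply_single]

lemma d_letterMonomial (hLeib : ∀ u v : Gr, d (u * v) = d u * v + u * d v)
    (hd : ∀ i j : ℕ, d (gen i j) = gen i (j + 1)) (e : Fin 5 → ℕ) :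
    d (letterMonomial e) = ∑ i, letterMonomial (e + Pi.single i 1) := by
  simp only [letterMonomial_eq_mul, Fin.sum_univ_five, hLeib, hd, add_mul, Pi.add_apply]
  simp

lemma letterCoeff_d (hLeib : ∀ u v : Gr, d (u * v) = d u * v + u * d v)
    (hd : ∀ i j : ℕ, d (gen i j) = gen i (j + 1)) (i k : Fin 5) :
    letterCoeff (Pi.single k 2) (d (letterMonomial (Pi.single i 1))) = if i = k then 1 else 0 := by
  rw [d_letterMonomial hLeib hd, map_sum]
  simp only [letterCoeff_letterMonomial]
  revert i k
  decide

lemma derivCombination_injective (hLeib : ∀ u v : Gr, d (u * v) = d u * v + u * d v)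
    (hd : ∀ i j : ℕ, d (gen i j) = gen i (j + 1)) : Function.Injective (derivCombination d) := by
  rw [injective_iff_map_eq_zero]
  intro c hc
  ext k
  have := congrArg (letterCoeff (Pi.single k 2)) hc
  simpa [derivCombination, Fintype.linearCombination_apply, letterCoeff_d hLeib hd] using this

/-- A word in which the letters `σ 0, …, σ 4` appear in this order is, up to sign, determined by
the set of letters in the inner bracket. -/
lemma words_eq (hLeib : ∀ u v : Gr, d (u * v) = d u * v + u * d v)
    (hd : ∀ i j : ℕ, d (gen i j) = gen i (j + 1)) (σ : Equiv.Perm (Fin 5)) :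
    -d (-d (g (σ 0) * g (σ 1) * g (σ 2)) * g (σ 3) * g (σ 4)) = Equiv.Perm.sign σ •
        derivCombination d (Pi.single (σ 0) 1 + Pi.single (σ 1) 1 + Pi.single (σ 2) 1) ∧
    -d (g (σ 0) * -d (g (σ 1) * g (σ 2) * g (σ 3)) * g (σ 4)) = Equiv.Perm.sign σ •
        derivCombination d (Pi.single (σ 1) 1 + Pi.single (σ 2) 1 + Pi.single (σ 3) 1) ∧
    -d (g (σ 0) * g (σ 1) * -d (g (σ 2) * g (σ 3) * g (σ 4))) = Equiv.Perm.sign σ •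
        derivCombination d (Pi.single (σ 2) 1 + Pi.single (σ 3) 1 + Pi.single (σ 4) 1) := by
  have hsmul : ∀ x : Gr, Equiv.Perm.sign σ • d x = d (Equiv.Perm.sign σ • x) := fun x => by
    simp only [Units.smul_def, map_zsmul]
  simp only [map_add, derivCombination_single, smul_add, hsmul, ← gen_perm_mul]
  simp only [Pi.single_apply, EmbeddingLike.apply_eq_iff_eq]
  refine ⟨?_, ?_, ?_⟩ <;>
  · rw [← map_neg, ← map_add, ← map_add]
    congr 1
    simp only [hLeib, hd]
    simp [mul_add, add_mul, mul_assoc]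

lemma span_words_eq (hLeib : ∀ u v : Gr, d (u * v) = d u * v + u * d v)
    (hd : ∀ i j : ℕ, d (gen i j) = gen i (j + 1)) :
    Submodule.span (ZMod 3)
        {x : Gr | IsWord3 g (fun a b c => -d (a * b * c)) x (({0, 1, 2, 3, 4} : Multiset ℕ))} =
      (LinearMap.ker coordSum).map (derivCombination d) := by
  have hsign : ∀ (S : Submodule (ZMod 3) Gr) (σ : Equiv.Perm (Fin 5)) (y : Gr),
      Equiv.Perm.sign σ • y ∈ S ↔ y ∈ S := fun S σ y => by
    rcases Int.units_eq_one_or (Equiv.Perm.sign σ) with h | h <;> simp [h, Units.smul_def]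
  apply le_antisymm
  · rw [Submodule.span_le]
    intro x hx
    obtain ⟨p, hp, hx⟩ := IsWord3.exists_of_card_eq_five hx rfl
    obtain ⟨σ, hσ⟩ := exists_perm_of_map_univ_eq hp
    have hmem : ∀ i j k : Fin 5, Pi.single i 1 + Pi.single j 1 + Pi.single k 1 ∈
        LinearMap.ker coordSum := fun i j k => by
      simp only [LinearMap.mem_ker, coordSum, map_add, LinearMap.sum_apply, LinearMap.proj_apply,
        Finset.sum_pi_single', Finset.mem_univ, if_true]
      decide
    obtain ⟨w₁, w₂, w₃⟩ := words_eq hLeib hd σ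
    simp only [hσ, w₁, w₂, w₃] at hx
    rcases hx with rfl | rfl | rfl <;>
      exact (hsign _ _ _).mpr (Submodule.mem_map_of_mem (hmem _ _ _))
  · set S := Submodule.span (ZMod 3)
      {x : Gr | IsWord3 g (fun a b c => -d (a * b * c)) x (({0, 1, 2, 3, 4} : Multiset ℕ))}
    have hword : ∀ σ : Equiv.Perm (Fin 5), derivCombination d
        (Pi.single (σ 0) 1 + Pi.single (σ 1) 1 + Pi.single (σ 2) 1) ∈ S := fun σ => by
      rw [← hsign S σ, ← (words_eq hLeib hd σ).1]
      apply Submodule.subset_span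
      have hL : ({0, 1, 2, 3, 4} : Multiset ℕ) =
          {(σ 0 : ℕ)} + {(σ 1 : ℕ)} + {(σ 2 : ℕ)} + {(σ 3 : ℕ)} + {(σ 4 : ℕ)} := by
        have := congrArg (Multiset.map Fin.val) (Multiset.map_univ_val_equiv σ)
        exact this.symm
      rw [Set.mem_ofPred_eq, hL]
      exact .node (.node (.letter _) (.letter _) (.letter _)) (.letter _) (.letter _)
    have hdiff : ∀ i : Fin 5, derivCombination d (Pi.single i 1 - Pi.single 4 1) ∈ S := fun i => by
      have h := S.sub_mem (hword (Equiv.swap 0 i)) (hword (Equiv.swap i 4 * Equiv.swap 0 i))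
      rw [← map_sub] at h
      convert h using 2
      clear h
      revert i
      decide
    rintro _ ⟨c, hc, rfl⟩
    have hc : ∑ i, c i = 0 := by simpa [coordSum] using hc
    have hdecomp : c = ∑ i, c i • (Pi.single i 1 - Pi.single 4 1) := by
      simp only [smul_sub, Finset.sum_sub_distrib, ← Finset.sum_smul, hc, zero_smul, sub_zero]
      exact pi_eq_sum_univ' c
    rw [hdecomp, map_sum]
    exact S.sum_mem fun i _ => by
      rw [map_smul]
      exact S.smul_mem _ (hdiff i)

end

/-- the `𝔽₃`-span of all 3-words in the letters g₀,…,g₄ (once each)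
has dimension `4`. -/
theorem stmt_7 (d : Gr →ₗ[ZMod 3] Gr)
    (hLeib : ∀ u v : Gr, d (u * v) = d u * v + u * d v)
    (hd : ∀ i j : ℕ, d (gen i j) = gen i (j + 1)) :
    Module.finrank (ZMod 3)
      ↥(Submodule.span (ZMod 3)
        {x : Gr | IsWord3 g (fun a b c => -d (a * b * c)) x (({0, 1, 2, 3, 4} : Multiset ℕ))}) = 4 := by
  rw [span_words_eq hLeib hd,
    ← (Submodule.equivMapOfInjective _ (derivCombination_injective hLeib hd) _).finrank_eq,
    finrank_ker_coordSum]
end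

section
/- With G, d, T, gᵢ and the notion of 3-word as in the context, the 𝔽₃-subspace of G spanned by all 3-words in which each of the seven letters g₀, g₁, g₂, g₃, g₄, g₅, g₆ occurs exactly once has 𝔽₃-dimension 20. -/
open MvPolynomial

/-- The product of the generators `i^{(J i)}`, with `i` running through the list `l`. -/
noncomputable def letterProd (l : List ℕ) (J : ℕ →₀ ℕ) : Gr :=
  (l.map fun i => gen i (J i)).prod

/-- The linear map that sends the monomial `X^J` to `letterProd l J`. -/
noncomputable def realize (l : List ℕ) : MvPolynomial ℕ (ZMod 3) →ₗ[ZMod 3] Gr :=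
  (basisMonomials ℕ (ZMod 3)).constr (ZMod 3) (letterProd l)

/-- The sum of the variables indexed by the letters of `L`. -/
noncomputable def letterSum (L : Multiset ℕ) : MvPolynomial ℕ (ZMod 3) :=
  (L.map X).sum

lemma realize_monomial (l : List ℕ) (J : ℕ →₀ ℕ) (c : ZMod 3) :
    realize l (monomial J c) = c • letterProd l J := by
  have h : monomial J c = c • basisMonomials ℕ (ZMod 3) J := by
    simp [smul_monomial]
  rw [h, map_smul, realize, Module.Basis.constr_basis]

lemma letterProd_congr {l : List ℕ} {J K : ℕ →₀ ℕ} (h : ∀ i ∈ l, J i = K i) :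
    letterProd l J = letterProd l K := by
  unfold letterProd
  congr 1
  exact List.map_congr_left fun i hi => by rw [h i hi]

lemma letterProd_cons (a : ℕ) (l : List ℕ) (J : ℕ →₀ ℕ) :
    letterProd (a :: l) J = gen a (J a) * letterProd l J := by
  simp [letterProd]

lemma letterProd_append_add {l m : List ℕ} (hlm : l.Disjoint m) {J K : ℕ →₀ ℕ}
    (hJ : ∀ i ∈ J.support, i ∈ l) (hK : ∀ i ∈ K.support, i ∈ m) :
    letterProd (l ++ m) (J + K) = letterProd l J * letterProd m K := by
  have hl : letterProd l (J + K) = letterProd l J := letterProd_congr fun i hi => by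
    have : K i = 0 := by
      by_contra h
      exact hlm hi (hK i (Finsupp.mem_support_iff.2 h))
    simp [this]
  have hm : letterProd m (J + K) = letterProd m K := letterProd_congr fun i hi => by
    have : J i = 0 := by
      by_contra h
      exact hlm (hJ i (Finsupp.mem_support_iff.2 h)) hi
    simp [this]
  rw [← hl, ← hm]
  simp [letterProd]

lemma realize_append_mul {l m : List ℕ} (hlm : l.Disjoint m) {p q : MvPolynomial ℕ (ZMod 3)}
    (hp : p ∈ supported (ZMod 3) {i | i ∈ l}) (hq : q ∈ supported (ZMod 3) {i | i ∈ m}) :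
    realize (l ++ m) (p * q) = realize l p * realize m q := by
  rw [mem_supported] at hp hq
  have hJ : ∀ J ∈ p.support, ∀ i ∈ J.support, i ∈ l := fun J hJ i hi =>
    hp ((mem_vars_iff_mem_support i).2 ⟨J, hJ, hi⟩)
  have hK : ∀ K ∈ q.support, ∀ i ∈ K.support, i ∈ m := fun K hK i hi =>
    hq ((mem_vars_iff_mem_support i).2 ⟨K, hK, hi⟩)
  conv_lhs => rw [p.as_sum, q.as_sum]
  conv_rhs => rw [p.as_sum, q.as_sum]
  simp only [Finset.sum_mul_sum, map_sum, monomial_mul, realize_monomial]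
  refine Finset.sum_congr rfl fun J hJp => Finset.sum_congr rfl fun K hKq => ?_
  rw [letterProd_append_add hlm (hJ J hJp) (hK K hKq), smul_mul_smul_comm]

lemma exists_sign_letterProd_perm {l m : List ℕ} (h : l.Perm m) :
    ∃ ε : ℤˣ, ∀ J, letterProd l J = ε • letterProd m J := by
  induction h with
  | nil => exact ⟨1, fun J => by simp⟩
  | cons a _ ih =>
    obtain ⟨ε, hε⟩ := ih
    exact ⟨ε, fun J => by rw [letterProd_cons, letterProd_cons, hε, mul_smul_comm]⟩
  | swap a b l =>
    refine ⟨-1, fun J => ?_⟩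
    have h := eq_neg_of_add_eq_zero_left (ExteriorAlgebra.ι_add_mul_swap (R := ZMod 3)
      (Finsupp.single (b, J b) (1 : ZMod 3)) (Finsupp.single (a, J a) (1 : ZMod 3)))
    simp only [letterProd_cons, ← mul_assoc, gen, h, Units.neg_smul, one_smul, neg_mul]
  | trans _ _ ih₁ ih₂ =>
    obtain ⟨ε₁, h₁⟩ := ih₁
    obtain ⟨ε₂, h₂⟩ := ih₂
    exact ⟨ε₁ * ε₂, fun J => by rw [h₁, h₂, mul_smul]⟩

lemma exists_sign_realize_perm {l m : List ℕ} (h : l.Perm m) :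
    ∃ ε : ℤˣ, ∀ p, realize l p = ε • realize m p := by
  obtain ⟨ε, hε⟩ := exists_sign_letterProd_perm h
  refine ⟨ε, fun p => ?_⟩
  induction p using MvPolynomial.induction_on' with
  | monomial J c => rw [realize_monomial, realize_monomial, hε, smul_comm]
  | add p q hp hq => rw [map_add, map_add, hp, hq, smul_add]

lemma map_letterProd {d : Gr →ₗ[ZMod 3] Gr}
    (hLeib : ∀ u v : Gr, d (u * v) = d u * v + u * d v)
    (hd : ∀ i j : ℕ, d (gen i j) = gen i (j + 1)) {l : List ℕ} (hl : l.Nodup) (J : ℕ →₀ ℕ) :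
    d (letterProd l J) = (l.map fun k => letterProd l (Finsupp.single k 1 + J)).sum := by
  induction l with
  | nil =>
    have h := hLeib 1 1
    simpa [letterProd] using h
  | cons a l ih =>
    obtain ⟨ha, hl⟩ := List.nodup_cons.1 hl
    have h₁ : letterProd l (Finsupp.single a 1 + J) = letterProd l J :=
      letterProd_congr fun i hi => by
        have : a ≠ i := fun h => ha (h ▸ hi)
        simp [this]
    have h₂ : (l.map fun k => letterProd (a :: l) (Finsupp.single k 1 + J)) =
        l.map fun k => gen a (J a) * letterProd l (Finsupp.single k 1 + J) :=
      List.map_congr_left fun k hk => by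
        have : k ≠ a := fun h => ha (h ▸ hk)
        simp [letterProd_cons, this]
    rw [List.map_cons, List.sum_cons, h₂, List.sum_map_mul_left, ← ih hl, letterProd_cons,
      letterProd_cons, hLeib, hd, h₁]
    simp [add_comm]

lemma map_realize {d : Gr →ₗ[ZMod 3] Gr}
    (hLeib : ∀ u v : Gr, d (u * v) = d u * v + u * d v)
    (hd : ∀ i j : ℕ, d (gen i j) = gen i (j + 1)) {l : List ℕ} (hl : l.Nodup)
    (p : MvPolynomial ℕ (ZMod 3)) :
    d (realize l p) = realize l (letterSum l * p) := by
  induction p using MvPolynomial.induction_on' with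
  | monomial J c =>
    rw [realize_monomial, map_smul, map_letterProd hLeib hd hl]
    simp [letterSum, ← List.sum_map_mul_right, map_list_sum, Function.comp_def, X, monomial_mul,
      realize_monomial, List.smul_sum]
  | add p q hp hq => rw [map_add, map_add, hp, hq, mul_add, map_add]

/-- `x` is the realization of the polynomial `p` along some ordering of the letters of `L`. -/
def Realizes (x : Gr) (L : Multiset ℕ) (p : MvPolynomial ℕ (ZMod 3)) : Prop :=
  p ∈ supported (ZMod 3) {i | i ∈ L} ∧ ∃ l : List ℕ, (l : Multiset ℕ) = L ∧ x = realize l p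

lemma realizes_letter (i : ℕ) : Realizes (g i) {i} 1 := by
  refine ⟨one_mem _, [i], rfl, ?_⟩
  have h : (1 : MvPolynomial ℕ (ZMod 3)) = monomial 0 1 := rfl
  rw [h, realize_monomial]
  simp [letterProd]

lemma letterSum_mem_supported (L : Multiset ℕ) :
    letterSum L ∈ supported (ZMod 3) {i | i ∈ L} := by
  refine multiset_sum_mem _ fun p hp => ?_
  obtain ⟨i, hi, rfl⟩ := Multiset.mem_map.1 hp
  exact X_mem_supported.2 hi

lemma Realizes.mul {x y : Gr} {L M : Multiset ℕ} {p q : MvPolynomial ℕ (ZMod 3)}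
    (hx : Realizes x L p) (hy : Realizes y M q) (hLM : Disjoint L M) :
    Realizes (x * y) (L + M) (p * q) := by
  obtain ⟨hp, l, rfl, rfl⟩ := hx
  obtain ⟨hq, m, rfl, rfl⟩ := hy
  refine ⟨mul_mem (supported_mono (fun i (hi : i ∈ l) => ?_) hp)
    (supported_mono (fun i (hi : i ∈ m) => ?_) hq),
    l ++ m, rfl, (realize_append_mul ?_ hp hq).symm⟩
  · simp [hi]
  · simp [hi]
  · exact Multiset.coe_disjoint l m |>.1 hLM

lemma Realizes.node {d : Gr →ₗ[ZMod 3] Gr}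
    (hLeib : ∀ u v : Gr, d (u * v) = d u * v + u * d v)
    (hd : ∀ i j : ℕ, d (gen i j) = gen i (j + 1)) {u v w : Gr} {L₁ L₂ L₃ : Multiset ℕ}
    {p q r : MvPolynomial ℕ (ZMod 3)} (hu : Realizes u L₁ p) (hv : Realizes v L₂ q)
    (hw : Realizes w L₃ r) (hL : (L₁ + L₂ + L₃).Nodup) :
    Realizes (-d (u * v * w)) (L₁ + L₂ + L₃) (-(letterSum (L₁ + L₂ + L₃) * (p * q * r))) := by
  have h₁₂ := (Multiset.nodup_add.1 hL)
  obtain ⟨hp, l, hl, h⟩ := (hu.mul hv (Multiset.nodup_add.1 h₁₂.1).2.2).mul hw h₁₂.2.2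
  refine ⟨neg_mem (mul_mem (letterSum_mem_supported _) hp), l, hl, ?_⟩
  rw [h, map_realize hLeib hd (Multiset.coe_nodup.1 (hl ▸ hL)), hl, map_neg]

/-- The shape of the polynomials that realize the 3-words in at most seven letters. -/
def WordShape (L : Multiset ℕ) (p : MvPolynomial ℕ (ZMod 3)) : Prop :=
  Odd L.card ∧ (L.card = 1 → p = 1) ∧ (L.card = 3 → p = -letterSum L) ∧
    (L.card = 5 → ∃ S ≤ L, S.card = 3 ∧ p = letterSum L * letterSum S) ∧
    (L.card = 7 → ∃ U V : Multiset ℕ, U.card = 3 ∧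
      (U ≤ V ∧ V ≤ L ∧ V.card = 5 ∨ U + V ≤ L ∧ V.card = 3) ∧
      p = -(letterSum L * (letterSum U * letterSum V)))

lemma WordShape.node {L₁ L₂ L₃ : Multiset ℕ} {p q r : MvPolynomial ℕ (ZMod 3)}
    (h₁ : WordShape L₁ p) (h₂ : WordShape L₂ q) (h₃ : WordShape L₃ r) :
    WordShape (L₁ + L₂ + L₃) (-(letterSum (L₁ + L₂ + L₃) * (p * q * r))) := by
  obtain ⟨⟨a, ha⟩, p_one, p_three, p_five, -⟩ := h₁
  obtain ⟨⟨b, hb⟩, q_one, q_three, q_five, -⟩ := h₂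
  obtain ⟨⟨c, hc⟩, r_one, r_three, r_five, -⟩ := h₃
  have le₁ : L₁ ≤ L₁ + L₂ + L₃ := add_assoc L₁ L₂ L₃ ▸ Multiset.le_add_right _ _
  have le₂ : L₂ ≤ L₁ + L₂ + L₃ := (Multiset.le_add_left _ _).trans (Multiset.le_add_right _ _)
  have le₃ : L₃ ≤ L₁ + L₂ + L₃ := Multiset.le_add_left _ _
  have le₁₂ : L₁ + L₂ ≤ L₁ + L₂ + L₃ := Multiset.le_add_right _ _
  have le₁₃ : L₁ + L₃ ≤ L₁ + L₂ + L₃ := by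
    rw [add_right_comm]
    exact Multiset.le_add_right _ _
  have le₂₃ : L₂ + L₃ ≤ L₁ + L₂ + L₃ := by
    rw [add_assoc]
    exact Multiset.le_add_left _ _
  refine ⟨⟨a + b + c + 1, by simp only [Multiset.card_add]; omega⟩, ?_, ?_, ?_, ?_⟩ <;>
    intro h <;> rw [Multiset.card_add, Multiset.card_add] at h
  · omega
  · rw [p_one (by omega), q_one (by omega), r_one (by omega)]
    ring
  · obtain h | h | h : a = 1 ∧ b = 0 ∧ c = 0 ∨ a = 0 ∧ b = 1 ∧ c = 0 ∨ a = 0 ∧ b = 0 ∧ c = 1 := by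
      omega
    · refine ⟨L₁, le₁, by omega, ?_⟩
      rw [p_three (by omega), q_one (by omega), r_one (by omega)]
      ring
    · refine ⟨L₂, le₂, by omega, ?_⟩
      rw [p_one (by omega), q_three (by omega), r_one (by omega)]
      ring
    · refine ⟨L₃, le₃, by omega, ?_⟩
      rw [p_one (by omega), q_one (by omega), r_three (by omega)]
      ring
  · obtain h | h | h | h | h | h : a = 2 ∧ b = 0 ∧ c = 0 ∨ a = 0 ∧ b = 2 ∧ c = 0 ∨
        a = 0 ∧ b = 0 ∧ c = 2 ∨ a = 1 ∧ b = 1 ∧ c = 0 ∨ a = 1 ∧ b = 0 ∧ c = 1 ∨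
        a = 0 ∧ b = 1 ∧ c = 1 := by
      omega
    · obtain ⟨S, hS, hS3, rfl⟩ := p_five (by omega)
      refine ⟨S, L₁, hS3, .inl ⟨hS, le₁, by omega⟩, ?_⟩
      rw [q_one (by omega), r_one (by omega)]
      ring
    · obtain ⟨S, hS, hS3, rfl⟩ := q_five (by omega)
      refine ⟨S, L₂, hS3, .inl ⟨hS, le₂, by omega⟩, ?_⟩
      rw [p_one (by omega), r_one (by omega)]
      ring
    · obtain ⟨S, hS, hS3, rfl⟩ := r_five (by omega)
      refine ⟨S, L₃, hS3, .inl ⟨hS, le₃, by omega⟩, ?_⟩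
      rw [p_one (by omega), q_one (by omega)]
      ring
    · refine ⟨L₁, L₂, by omega, .inr ⟨le₁₂, by omega⟩, ?_⟩
      rw [p_three (by omega), q_three (by omega), r_one (by omega)]
      ring
    · refine ⟨L₁, L₃, by omega, .inr ⟨le₁₃, by omega⟩, ?_⟩
      rw [p_three (by omega), q_one (by omega), r_three (by omega)]
      ring
    · refine ⟨L₂, L₃, by omega, .inr ⟨le₂₃, by omega⟩, ?_⟩
      rw [p_one (by omega), q_three (by omega), r_three (by omega)]
      ring

lemma IsWord3.exists_realizes {d : Gr →ₗ[ZMod 3] Gr}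
    (hLeib : ∀ u v : Gr, d (u * v) = d u * v + u * d v)
    (hd : ∀ i j : ℕ, d (gen i j) = gen i (j + 1)) {x : Gr} {L : Multiset ℕ}
    (hx : IsWord3 g (fun a b c => -d (a * b * c)) x L) (hL : L.Nodup) :
    ∃ p, Realizes x L p ∧ WordShape L p := by
  induction hx with
  | letter i => exact ⟨1, realizes_letter i, by simp [WordShape]⟩
  | node _ _ _ ih₁ ih₂ ih₃ =>
    have h₁₂ := (Multiset.nodup_add.1 hL)
    obtain ⟨p, hp, hp'⟩ := ih₁ (Multiset.nodup_add.1 h₁₂.1).1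
    obtain ⟨q, hq, hq'⟩ := ih₂ (Multiset.nodup_add.1 h₁₂.1).2.1
    obtain ⟨r, hr, hr'⟩ := ih₃ h₁₂.2.1
    exact ⟨_, hp.node hLeib hd hq hr hL, hp'.node hq' hr'⟩

/-- The alternating map sending vectors `v₀, …, v₆` to the determinant of the matrix with entries
`∑ j, vᵢ (k, j) X_k ^ j`. -/
noncomputable def symbolAlternating :
    ((ℕ × ℕ) →₀ ZMod 3) [⋀^Fin 7]→ₗ[ZMod 3] MvPolynomial (Fin 7) (ZMod 3) :=
  AlternatingMap.compLinearMap
    { (Matrix.detRowAlternating (n := Fin 7)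
        (R := MvPolynomial (Fin 7) (ZMod 3))).toMultilinearMap.restrictScalars (ZMod 3) with
      map_eq_zero_of_eq' := fun M _ _ h hij => by
        exact Matrix.det_zero_of_row_eq hij h }
    (Finsupp.linearCombination (ZMod 3) fun (a : ℕ × ℕ) (k : Fin 7) =>
      if a.1 = k then (X k ^ a.2 : MvPolynomial (Fin 7) (ZMod 3)) else 0)

/-- The linear extension of `symbolAlternating` to the Grassmann algebra. -/
noncomputable def symbol : Gr →ₗ[ZMod 3] MvPolynomial (Fin 7) (ZMod 3) :=
  ExteriorAlgebra.liftAlternating (Pi.single 7 symbolAlternating)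

lemma symbol_letterProd (J : ℕ →₀ ℕ) :
    symbol (letterProd (List.range 7) J) = ∏ k : Fin 7, X k ^ J k := by
  have h : letterProd (List.range 7) J = ExteriorAlgebra.ιMulti (ZMod 3) 7
      fun i : Fin 7 => Finsupp.single ((i : ℕ), J i) (1 : ZMod 3) := by
    rw [ExteriorAlgebra.ιMulti_apply]
    rfl
  rw [h, symbol, ExteriorAlgebra.liftAlternating_apply_ιMulti, Pi.single_eq_same]
  change Matrix.det (n := Fin 7) (R := MvPolynomial (Fin 7) (ZMod 3)) _ = _
  rw [← Matrix.det_diagonal (R := MvPolynomial (Fin 7) (ZMod 3))]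
  congr 1
  ext i k : 2
  simp [Matrix.diagonal_apply, Fin.val_inj]
  split_ifs with h
  · rw [h]
  · rfl

/-- The algebra map that keeps the variables `X 0, …, X 6` and sets the others to `1`. -/
noncomputable def truncate : MvPolynomial ℕ (ZMod 3) →ₐ[ZMod 3] MvPolynomial (Fin 7) (ZMod 3) :=
  aeval fun k => if h : k < 7 then X ⟨k, h⟩ else 1

lemma truncate_X (k : Fin 7) : truncate (X (k : ℕ)) = X k := by
  simp [truncate]

lemma symbol_realize (p : MvPolynomial ℕ (ZMod 3)) :
    symbol (realize (List.range 7) p) = truncate p := by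
  induction p using MvPolynomial.induction_on' with
  | monomial J c =>
    rw [realize_monomial, map_smul, symbol_letterProd, truncate, aeval_monomial, Algebra.smul_def]
    congr 1
    rw [Finsupp.prod_of_support_subset J (s := J.support ∪ Finset.range 7)
      Finset.subset_union_left _ (fun _ _ => pow_zero _),
      ← Finset.prod_subset Finset.subset_union_right fun k _ hk => ?_]
    · rw [← Fin.prod_univ_eq_prod_range]
      exact Finset.prod_congr rfl fun k _ => by simp
    · rw [dif_neg (by simpa using hk), one_pow]
  | add p q hp hq => rw [map_add, map_add, hp, hq, map_add]

/-- The quadratic form of a matrix, as a polynomial in the variables `X 0, …, X 6`. -/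
noncomputable def quadForm :
    Matrix (Fin 7) (Fin 7) (ZMod 3) →ₗ[ZMod 3] MvPolynomial ℕ (ZMod 3) where
  toFun A := ∑ i, ∑ j, A i j • (X (i : ℕ) * X (j : ℕ))
  map_add' A B := by simp [add_smul, Finset.sum_add_distrib]
  map_smul' c A := by simp [Finset.smul_sum, mul_smul]

/-- The element of the Grassmann algebra realizing the quadratic form of a matrix, multiplied by
the sum of the variables. -/
noncomputable def wordMap : Matrix (Fin 7) (Fin 7) (ZMod 3) →ₗ[ZMod 3] Gr :=
  realize (List.range 7) ∘ₗ LinearMap.mulLeft (ZMod 3) (letterSum (Multiset.range 7)) ∘ₗ quadForm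

/-- The symmetric matrices of trace zero all of whose off-diagonal row sums vanish. -/
def wordSpace : Submodule (ZMod 3) (Matrix (Fin 7) (Fin 7) (ZMod 3)) where
  carrier := {A | A.IsSymm ∧ (∀ i, ∑ j, A i j = A i i) ∧ A.trace = 0}
  zero_mem' := by simp [Matrix.isSymm_zero]
  add_mem' := fun ⟨h₁, h₂, h₃⟩ ⟨k₁, k₂, k₃⟩ =>
    ⟨h₁.add k₁, fun i => by simp [Finset.sum_add_distrib, h₂, k₂], by simp [h₃, k₃]⟩
  smul_mem' := fun c _ ⟨h₁, h₂, h₃⟩ =>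
    ⟨h₁.smul c, fun i => by simp [← Finset.mul_sum, h₂], by simp [h₃]⟩

lemma quadForm_eval (A : Matrix (Fin 7) (Fin 7) (ZMod 3)) (x : Fin 7 → ZMod 3) :
    eval x (truncate (quadForm A)) = ∑ i, ∑ j, A i j * (x i * x j) := by
  simp [quadForm, truncate_X]

lemma wordMap_injOn {A : Matrix (Fin 7) (Fin 7) (ZMod 3)} (hA : A.IsSymm)
    (h : wordMap A = 0) : A = 0 := by
  have h₁ : truncate (letterSum (Multiset.range 7)) * truncate (quadForm A) = 0 := by
    rw [← map_mul, ← symbol_realize]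
    exact (congrArg symbol h).trans (map_zero _)
  have h₂ : truncate (letterSum (Multiset.range 7)) ≠ 0 := fun h => by
    have := congrArg (eval (Pi.single 0 1)) h
    have hs : letterSum (Multiset.range 7) = ∑ i : Fin 7, X (i : ℕ) :=
      (Fin.sum_univ_eq_sum_range (fun i => (X i : MvPolynomial ℕ (ZMod 3))) 7).symm
    rw [hs] at this
    simp [truncate_X] at this
  have h₃ (x : Fin 7 → ZMod 3) : ∑ i, ∑ j, A i j * (x i * x j) = 0 := by
    rw [← quadForm_eval, (mul_eq_zero.1 h₁).resolve_left h₂, map_zero]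
  have h₄ (i : Fin 7) : A i i = 0 := by
    simpa [Pi.single_apply] using h₃ (Pi.single i 1)
  ext i j
  have h₅ := h₃ (Pi.single i 1 + Pi.single j 1)
  simp [Pi.single_apply, mul_add, Finset.sum_add_distrib, h₄, hA.apply i j] at h₅
  have h2 : (2 : ZMod 3) ≠ 0 := by decide
  rw [← two_mul] at h₅
  exact (mul_eq_zero.1 h₅).resolve_left h2

/-- The symmetrized product of two vectors. -/
def symProd (u v : Fin 7 → ZMod 3) : Matrix (Fin 7) (Fin 7) (ZMod 3) :=
  Matrix.of fun i j => u i * v j + v i * u j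

lemma quadForm_symProd (u v : Fin 7 → ZMod 3) :
    quadForm (symProd u v) =
      -((∑ i, u i • X (i : ℕ)) * ∑ i, v i • X (i : ℕ)) := by
  have h : (-1 : ZMod 3) = 1 + 1 := by decide
  rw [← neg_one_smul (ZMod 3), h, add_smul, one_smul]
  nth_rewrite 2 [mul_comm]
  rw [Finset.sum_mul_sum, Finset.sum_mul_sum, ← Finset.sum_add_distrib]
  simp only [quadForm, symProd, LinearMap.coe_mk, AddHom.coe_mk, Matrix.of_apply, add_smul,
    smul_mul_smul_comm, Finset.sum_add_distrib]

lemma symProd_mem_wordSpace {u v : Fin 7 → ZMod 3} (hu : ∑ i, u i = 0)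
    (huv : ∀ i, u i * v i = -(u i * ∑ j, v j)) : symProd u v ∈ wordSpace := by
  refine ⟨?_, fun i => ?_, ?_⟩
  · ext i j
    simp [symProd]
    ring
  · simp only [symProd, Matrix.of_apply, Finset.sum_add_distrib, ← Finset.mul_sum, hu]
    have h3 : (3 : ZMod 3) = 0 := by decide
    linear_combination (-2) * huv i + u i * (∑ j, v j) * h3
  · simp only [Matrix.trace, Matrix.diag, symProd, Matrix.of_apply, Finset.sum_add_distrib,
      mul_comm (v _), huv, Finset.sum_neg_distrib, ← Finset.sum_mul, hu]
    simp

/-- The vector of multiplicities of the letters `0, …, 6` in a multiset, modulo `3`. -/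
def countVec (U : Multiset ℕ) (i : Fin 7) : ZMod 3 := (U.count (i : ℕ) : ZMod 3)

lemma letterSum_eq_sum_countVec {U : Multiset ℕ} (hU : U ≤ Multiset.range 7) :
    letterSum U = ∑ i : Fin 7, countVec U i • X (i : ℕ) := by
  have h : U.toFinset ⊆ Finset.range 7 := fun i hi =>
    Finset.mem_range.2 (Multiset.mem_range.1 (Multiset.mem_of_le hU (Multiset.mem_toFinset.1 hi)))
  rw [letterSum, Finset.sum_multiset_map_count, Finset.sum_subset h fun i _ hi => by
    rw [Multiset.count_eq_zero_of_notMem (fun h => hi (Multiset.mem_toFinset.2 h)), zero_smul],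
    ← Fin.sum_univ_eq_sum_range]
  simp only [countVec, Nat.cast_smul_eq_nsmul]

lemma sum_countVec {U : Multiset ℕ} (hU : U ≤ Multiset.range 7) :
    ∑ i, countVec U i = (U.card : ZMod 3) := by
  have h : ∀ i ∈ U, i ∈ Finset.range 7 := fun i hi =>
    Finset.mem_range.2 (Multiset.mem_range.1 (Multiset.mem_of_le hU hi))
  rw [← Multiset.sum_count_eq_card h, ← Fin.sum_univ_eq_sum_range]
  simp [countVec]

lemma Realizes.exists_eq_wordMap {x : Gr} {U V : Multiset ℕ} (hU : U ≤ Multiset.range 7)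
    (hV : V ≤ Multiset.range 7)
    (h : Realizes x (Multiset.range 7)
      (-(letterSum (Multiset.range 7) * (letterSum U * letterSum V)))) :
    ∃ ε : ℤˣ, x = ε • wordMap (symProd (countVec U) (countVec V)) := by
  obtain ⟨-, l, hl, rfl⟩ := h
  obtain ⟨ε, hε⟩ := exists_sign_realize_perm (Multiset.coe_eq_coe.1 hl)
  refine ⟨ε, ?_⟩
  rw [hε, wordMap, LinearMap.comp_apply, LinearMap.comp_apply, LinearMap.mulLeft_apply,
    quadForm_symProd, ← letterSum_eq_sum_countVec hU, ← letterSum_eq_sum_countVec hV, mul_neg]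

lemma symProd_countVec_mem_wordSpace {U V : Multiset ℕ} (hU : U.card = 3)
    (h : U ≤ V ∧ V ≤ Multiset.range 7 ∧ V.card = 5 ∨ U + V ≤ Multiset.range 7 ∧ V.card = 3) :
    symProd (countVec U) (countVec V) ∈ wordSpace := by
  have hU' : U ≤ Multiset.range 7 :=
    h.elim (fun h => h.1.trans h.2.1) fun h => (Multiset.le_add_right U V).trans h.1
  have hV' : V ≤ Multiset.range 7 :=
    h.elim (fun h => h.2.1) fun h => (Multiset.le_add_left V U).trans h.1
  refine symProd_mem_wordSpace (by rw [sum_countVec hU', hU]; rfl) fun i => ?_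
  rw [sum_countVec hV']
  have nodup := Multiset.nodup_iff_count_le_one.1 (Multiset.nodup_range 7) (i : ℕ)
  obtain ⟨hUV, -, h5⟩ | ⟨hUV, h3⟩ := h
  · have h₁ := Multiset.count_le_of_le (i : ℕ) hUV
    have h₂ := Multiset.count_le_of_le (i : ℕ) hV'
    obtain h | ⟨h, h'⟩ : U.count (i : ℕ) = 0 ∨ U.count (i : ℕ) = 1 ∧ V.count (i : ℕ) = 1 := by
      omega
    · simp [countVec, h]
    · rw [countVec, countVec, h, h', h5]
      decide
  · have h₁ := Multiset.count_le_of_le (i : ℕ) hUV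
    rw [Multiset.count_add] at h₁
    have h₂ : ((3 : ℕ) : ZMod 3) = 0 := rfl
    obtain h | h : U.count (i : ℕ) = 0 ∨ V.count (i : ℕ) = 0 := by
      omega
    · simp [countVec, h]
    · rw [h3, h₂]
      simp [countVec, h]

lemma intUnits_smul_mem_iff (S : Submodule (ZMod 3) Gr) (ε : ℤˣ) (x : Gr) :
    ε • x ∈ S ↔ x ∈ S := by
  obtain rfl | rfl := Int.units_eq_one_or ε <;> simp

lemma IsWord3.mem_map_wordMap {d : Gr →ₗ[ZMod 3] Gr}
    (hLeib : ∀ u v : Gr, d (u * v) = d u * v + u * d v)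
    (hd : ∀ i j : ℕ, d (gen i j) = gen i (j + 1)) {x : Gr}
    (hx : IsWord3 g (fun a b c => -d (a * b * c)) x (Multiset.range 7)) :
    x ∈ wordSpace.map wordMap := by
  obtain ⟨p, hp, -, -, -, -, h⟩ := hx.exists_realizes hLeib hd (Multiset.nodup_range 7)
  obtain ⟨U, V, hU, hUV, rfl⟩ := h (Multiset.card_range 7)
  have hU' : U ≤ Multiset.range 7 :=
    hUV.elim (fun h => h.1.trans h.2.1) fun h => (Multiset.le_add_right U V).trans h.1
  have hV' : V ≤ Multiset.range 7 :=
    hUV.elim (fun h => h.2.1) fun h => (Multiset.le_add_left V U).trans h.1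
  obtain ⟨ε, rfl⟩ := hp.exists_eq_wordMap hU' hV'
  rw [intUnits_smul_mem_iff]
  exact Submodule.mem_map_of_mem (symProd_countVec_mem_wordSpace hU hUV)

lemma exists_isWord3_eq_wordMap {d : Gr →ₗ[ZMod 3] Gr}
    (hLeib : ∀ u v : Gr, d (u * v) = d u * v + u * d v)
    (hd : ∀ i j : ℕ, d (gen i j) = gen i (j + 1)) {a : Fin 7 → ℕ}
    (ha : {a 0} + {a 1} + {a 2} + {a 3} + {a 4} + {a 5} + {a 6} = Multiset.range 7) :
    ∃ x, IsWord3 g (fun a b c => -d (a * b * c)) x (Multiset.range 7) ∧ ∃ ε : ℤˣ,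
      x = ε • wordMap (symProd (countVec ({a 0} + {a 1} + {a 2}))
        (countVec ({a 0} + {a 1} + {a 2} + {a 3} + {a 4}))) := by
  have le₅ : {a 0} + {a 1} + {a 2} + {a 3} + {a 4} ≤ Multiset.range 7 := by
    rw [← ha, add_assoc _ {a 5}]
    exact Multiset.le_add_right _ _
  have le₃ : {a 0} + {a 1} + {a 2} ≤ Multiset.range 7 := by
    refine le_trans ?_ le₅
    rw [add_assoc _ {a 3}]
    exact Multiset.le_add_right _ _
  have nodup := Multiset.nodup_range 7
  have h₃ := (realizes_letter (a 0)).node hLeib hd (realizes_letter (a 1)) (realizes_letter (a 2))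
    (Multiset.nodup_of_le le₃ nodup)
  have h₅ := h₃.node hLeib hd (realizes_letter (a 3)) (realizes_letter (a 4))
    (Multiset.nodup_of_le le₅ nodup)
  have h₇ := h₅.node hLeib hd (realizes_letter (a 5)) (realizes_letter (a 6)) (ha ▸ nodup)
  refine ⟨_, ha ▸ ((((IsWord3.letter (a 0)).node (.letter (a 1)) (.letter (a 2))).node
    (.letter (a 3)) (.letter (a 4))).node (.letter (a 5)) (.letter (a 6))),
    Realizes.exists_eq_wordMap le₃ le₅ ?_⟩
  rw [ha] at h₇
  convert h₇ using 1
  ring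

/-- Positions of entries that determine a matrix in `wordSpace`. -/
def position : Fin 20 → Fin 7 × Fin 7 :=
  ![(0, 0), (1, 1), (2, 2), (3, 3), (4, 4), (5, 5), (0, 2), (0, 3), (0, 4), (0, 5),
    (1, 2), (1, 3), (1, 4), (1, 5), (2, 3), (2, 4), (2, 5), (3, 4), (3, 5), (4, 5)]

/-- Arrangements of the letters for which the words `T(T(T(a₀,a₁,a₂),a₃,a₄),a₅,a₆)` form a
basis. -/
def arrangement : Fin 20 → Fin 7 → ℕ :=
  ![![0, 3, 6, 1, 5, 2, 4], ![0, 4, 5, 3, 6, 1, 2], ![0, 1, 3, 5, 6, 2, 4],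
    ![1, 4, 6, 3, 5, 0, 2], ![0, 3, 5, 2, 6, 1, 4], ![2, 4, 5, 0, 6, 1, 3],
    ![1, 2, 3, 4, 6, 0, 5], ![1, 3, 4, 0, 5, 2, 6], ![1, 5, 6, 2, 4, 0, 3],
    ![3, 4, 6, 1, 5, 0, 2], ![1, 5, 6, 0, 3, 2, 4], ![0, 1, 5, 3, 4, 2, 6],
    ![0, 4, 6, 1, 5, 2, 3], ![2, 3, 4, 0, 1, 5, 6], ![0, 5, 6, 1, 4, 2, 3],
    ![4, 5, 6, 0, 2, 1, 3], ![0, 2, 4, 3, 5, 1, 6], ![2, 3, 5, 0, 1, 4, 6],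
    ![0, 1, 3, 2, 5, 4, 6], ![0, 1, 2, 3, 5, 4, 6]]

/-- The inverse of the matrix of entries at `position` of the words given by `arrangement`. -/
def coefficient : Matrix (Fin 20) (Fin 20) (ZMod 3) :=
  !![2, 1, 0, 0, 1, 0, 1, 2, 2, 2, 2, 2, 0, 1, 2, 0, 0, 2, 1, 2;
    2, 0, 0, 1, 2, 1, 1, 0, 0, 0, 1, 1, 2, 0, 0, 1, 1, 0, 1, 0;
    2, 0, 0, 0, 0, 0, 0, 0, 0, 0, 2, 0, 0, 0, 0, 0, 0, 1, 0, 1;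
    1, 1, 0, 2, 2, 0, 1, 2, 0, 2, 1, 1, 0, 0, 2, 2, 0, 0, 0, 2;
    0, 0, 0, 1, 0, 1, 2, 0, 0, 2, 2, 2, 0, 1, 2, 0, 0, 2, 2, 0;
    0, 0, 2, 2, 1, 1, 2, 1, 2, 2, 1, 0, 0, 0, 2, 1, 2, 0, 1, 1;
    2, 1, 0, 2, 0, 1, 2, 2, 0, 1, 2, 0, 0, 1, 0, 2, 2, 0, 1, 0;
    2, 0, 0, 0, 0, 2, 1, 2, 0, 0, 0, 2, 0, 2, 1, 0, 0, 1, 1, 0;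
    2, 0, 0, 1, 0, 0, 0, 2, 0, 2, 0, 0, 1, 0, 0, 0, 0, 0, 0, 0;
    1, 1, 0, 2, 1, 1, 2, 1, 2, 0, 2, 1, 1, 0, 0, 1, 2, 0, 1, 1;
    2, 1, 0, 2, 0, 2, 2, 0, 0, 2, 0, 2, 0, 2, 2, 1, 2, 1, 0, 0;
    0, 1, 0, 2, 2, 1, 1, 1, 0, 1, 1, 0, 1, 0, 0, 1, 1, 0, 1, 0;
    0, 0, 2, 2, 0, 1, 2, 0, 0, 0, 0, 1, 2, 1, 2, 0, 0, 2, 2, 0;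
    1, 2, 1, 2, 0, 0, 0, 2, 0, 2, 0, 1, 1, 0, 0, 0, 0, 0, 0, 0;
    2, 1, 2, 2, 0, 0, 2, 1, 0, 0, 1, 1, 0, 0, 1, 0, 2, 2, 0, 0;
    2, 1, 0, 1, 0, 0, 1, 1, 0, 0, 0, 0, 1, 0, 1, 1, 1, 0, 2, 1;
    1, 1, 0, 0, 0, 0, 0, 0, 0, 2, 0, 0, 2, 2, 2, 2, 0, 1, 0, 0;
    1, 0, 0, 0, 0, 0, 2, 0, 0, 2, 0, 1, 0, 1, 2, 1, 2, 2, 1, 2;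
    2, 0, 0, 1, 0, 0, 0, 1, 0, 0, 0, 1, 1, 0, 2, 0, 0, 0, 0, 0;
    0, 0, 1, 1, 0, 2, 2, 0, 0, 0, 2, 2, 2, 1, 2, 2, 1, 2, 0, 1]

/-- The matrix of the word given by an arrangement. -/
def arrangementMatrix (t : Fin 20) : Matrix (Fin 7) (Fin 7) (ZMod 3) :=
  symProd
    (countVec ({arrangement t 0} + {arrangement t 1} + {arrangement t 2}))
    (countVec ({arrangement t 0} + {arrangement t 1} + {arrangement t 2} + {arrangement t 3} +
      {arrangement t 4}))

lemma arrangement_sum (t : Fin 20) :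
    {arrangement t 0} + {arrangement t 1} + {arrangement t 2} + {arrangement t 3} +
      {arrangement t 4} + {arrangement t 5} + {arrangement t 6} = Multiset.range 7 := by
  revert t
  decide +kernel

/-- The entries of a matrix at the positions given by `position`. -/
def entries : Matrix (Fin 7) (Fin 7) (ZMod 3) →ₗ[ZMod 3] (Fin 20 → ZMod 3) where
  toFun A t := A (position t).1 (position t).2
  map_add' _ _ := rfl
  map_smul' _ _ := rfl

lemma sum_coefficient_smul_entries (s : Fin 20) :
    ∑ t, coefficient s t • entries (arrangementMatrix t) = Pi.single s 1 := by
  revert s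
  decide +kernel

lemma entries_injOn {A : Matrix (Fin 7) (Fin 7) (ZMod 3)} (hA : A ∈ wordSpace)
    (h : entries A = 0) : A = 0 := by
  obtain ⟨hs, hr, ht⟩ := hA
  have hp (t : Fin 20) : A (position t).1 (position t).2 = 0 := congrFun h t
  have hpos : ∀ i j : Fin 7, i ≠ 6 → j ≠ 6 → (i, j) ≠ (0, 1) → (i, j) ≠ (1, 0) →
      ∃ t, position t = (i, j) ∨ position t = (j, i) := by
    decide +kernel
  have h0 (i j : Fin 7) (hi : i ≠ 6) (hj : j ≠ 6) (h01 : (i, j) ≠ (0, 1))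
      (h10 : (i, j) ≠ (1, 0)) : A i j = 0 := by
    obtain ⟨t, ht | ht⟩ := hpos i j hi hj h01 h10
    · simpa [ht] using hp t
    · rw [hs.apply j i]
      simpa [ht] using hp t
  have h66 : A 6 6 = 0 := by
    rw [Matrix.trace, Finset.sum_eq_single 6 (fun k _ hk => ?_) (by simp)] at ht
    · exact ht
    · exact h0 k k hk hk (by grind) (by grind)
  have h6 (i : Fin 7) (hi : i ≠ 6) (hi0 : i ≠ 0) (hi1 : i ≠ 1) : A i 6 = 0 := by
    have := hr i
    rwa [Finset.sum_eq_single 6 (fun k _ hk => h0 i k hi hk (by grind) (by grind)) (by simp),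
      h0 i i hi hi (by grind) (by grind)] at this
  have hr0 : A 0 1 + A 0 6 = 0 := by
    have := hr 0
    rw [Fin.sum_univ_seven] at this
    simpa [h0] using this
  have hr1 : A 0 1 + A 1 6 = 0 := by
    have := hr 1
    rw [Fin.sum_univ_seven] at this
    simpa [h0, hs.apply 0 1] using this
  have hr6 : A 0 6 + A 1 6 = 0 := by
    have := hr 6
    rw [Fin.sum_univ_seven] at this
    simpa [h66, h6, hs.apply _ 6] using this
  have h2 : (2 : ZMod 3) ≠ 0 := by decide
  have h01 : A 0 1 = 0 := by
    refine (mul_eq_zero.1 (?_ : 2 * A 0 1 = 0)).resolve_left h2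
    linear_combination hr0 + hr1 - hr6
  have hcol (i : Fin 7) : A i 6 = 0 := by
    grind
  ext i j
  have hij := hs.apply i j
  have h10 := hs.apply 0 1
  rw [Matrix.zero_apply]
  grind

lemma span_arrangementMatrix :
    Submodule.span (ZMod 3) (Set.range arrangementMatrix) = wordSpace ∧
      Module.finrank (ZMod 3) wordSpace = 20 := by
  have hle : Submodule.span (ZMod 3) (Set.range arrangementMatrix) ≤ wordSpace := by
    rw [Submodule.span_le]
    rintro _ ⟨t, rfl⟩
    refine symProd_countVec_mem_wordSpace rfl (.inl ⟨?_, ?_, rfl⟩)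
    · rw [add_assoc _ {arrangement t 3}]
      exact Multiset.le_add_right _ _
    · rw [← arrangement_sum t, add_assoc _ {arrangement t 5}]
      exact Multiset.le_add_right _ _
  have hupper : Module.finrank (ZMod 3) wordSpace ≤ 20 := by
    have hinj : Function.Injective (entries.domRestrict wordSpace) :=
      (injective_iff_map_eq_zero _).2 fun A hA => Subtype.ext (entries_injOn A.2 hA)
    simpa using LinearMap.finrank_le_finrank_of_injective hinj
  have hlower : 20 ≤
      Module.finrank (ZMod 3) (Submodule.span (ZMod 3) (Set.range arrangementMatrix)) := by
    have htop : (Submodule.span (ZMod 3) (Set.range arrangementMatrix)).map entries = ⊤ := by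
      rw [eq_top_iff, ← (Pi.basisFun (ZMod 3) (Fin 20)).span_eq, Submodule.span_le]
      rintro _ ⟨s, rfl⟩
      rw [Pi.basisFun_apply, ← sum_coefficient_smul_entries]
      exact sum_mem fun t _ => Submodule.smul_mem _ _
        (Submodule.mem_map_of_mem (Submodule.subset_span ⟨t, rfl⟩))
    have h := Submodule.finrank_map_le entries
      (Submodule.span (ZMod 3) (Set.range arrangementMatrix))
    rwa [htop, finrank_top, Module.finrank_fin_fun] at h
  have heq := Submodule.eq_of_le_of_finrank_le hle (hupper.trans hlower)
  exact ⟨heq, le_antisymm hupper (heq ▸ hlower)⟩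

/-- the `𝔽₃`-span of all 3-words in the letters g₀,…,g₆ (once each)
has dimension `20`. -/
theorem stmt_10 (d : Gr →ₗ[ZMod 3] Gr)
    (hLeib : ∀ u v : Gr, d (u * v) = d u * v + u * d v)
    (hd : ∀ i j : ℕ, d (gen i j) = gen i (j + 1)) :
    Module.finrank (ZMod 3)
      ↥(Submodule.span (ZMod 3)
        {x : Gr | IsWord3 g (fun a b c => -d (a * b * c)) x (({0, 1, 2, 3, 4, 5, 6} : Multiset ℕ))}) = 20 := by
  have hL : ({0, 1, 2, 3, 4, 5, 6} : Multiset ℕ) = Multiset.range 7 := by decide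
  obtain ⟨hspan, hrank⟩ := span_arrangementMatrix
  have hW : Submodule.span (ZMod 3) {x : Gr | IsWord3 g (fun a b c => -d (a * b * c)) x
      (({0, 1, 2, 3, 4, 5, 6} : Multiset ℕ))} = wordSpace.map wordMap := by
    rw [hL]
    refine le_antisymm (Submodule.span_le.2 fun x hx => hx.mem_map_wordMap hLeib hd) ?_
    rw [← hspan, Submodule.map_span, Submodule.span_le]
    rintro _ ⟨_, ⟨t, rfl⟩, rfl⟩
    obtain ⟨x, hx, ε, hε⟩ := exists_isWord3_eq_wordMap hLeib hd (arrangement_sum t)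
    rw [SetLike.mem_coe, ← intUnits_smul_mem_iff _ ε]
    exact hε ▸ Submodule.subset_span hx
  have hinj : Function.Injective (wordMap.domRestrict wordSpace) :=
    (injective_iff_map_eq_zero _).2 fun A hA => Subtype.ext (wordMap_injOn A.2.1 hA)
  rw [hW, ← LinearMap.range_domRestrict, LinearMap.finrank_range_of_inj hinj, hrank]
end

section
/- Let M and T be as in the context, and assume that for every a ∈ M the map (x,y,z) ↦ T(T(x,y,a),a,z) is alternating in (x,y,z). Then for all x, i, j, p, q ∈ M: T(T(x,i,j),p,q) + T(T(x,i,p),j,q) + T(T(x,j,q),i,p) + T(T(x,p,q),i,j) = 0. -/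
/-- An alternating trilinear map changes sign when its last two arguments are swapped. -/
theorem trilinear_swap_last {M : Type*} [AddCommGroup M] [Module (ZMod 3) M]
    (T : M →ₗ[ZMod 3] M →ₗ[ZMod 3] M →ₗ[ZMod 3] M)
    (halt : ∀ x y z : M, x = y ∨ y = z ∨ x = z → T x y z = 0) (x y z : M) :
    T x z y = -T x y z := by
  have h := halt x (y + z) (y + z) (by simp)
  simp only [map_add, LinearMap.add_apply, halt x y y (by simp), halt x z z (by simp),
    zero_add, add_zero] at h
  exact eq_neg_of_add_eq_zero_left h

/-- Polarization, in `a`, of the vanishing of `T (T x y a) a y`. -/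
theorem trilinear_polarize {M : Type*} [AddCommGroup M] [Module (ZMod 3) M]
    (T : M →ₗ[ZMod 3] M →ₗ[ZMod 3] M →ₗ[ZMod 3] M)
    (hB : ∀ a x y z : M, x = y ∨ y = z ∨ x = z → T (T x y a) a z = 0) (x y a b : M) :
    T (T x y a) b y + T (T x y b) a y = 0 := by
  have h := hB (a + b) x y y (by simp)
  simpa only [map_add, LinearMap.add_apply, hB a x y y (by simp), hB b x y y (by simp),
    zero_add, add_zero, add_comm] using h

/-- Let `M` be a vector space over `𝔽₃` and `T` an alternating
trilinear map on `M`.  If for every `a` the map `(x,y,z) ↦ T (T x y a) a z` is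
alternating in `(x,y,z)`, then
`T (T x i j) p q + T (T x i p) j q + T (T x j q) i p + T (T x p q) i j = 0`. -/
theorem stmt_13 (M : Type*) [AddCommGroup M] [Module (ZMod 3) M]
    (T : M →ₗ[ZMod 3] M →ₗ[ZMod 3] M →ₗ[ZMod 3] M)
    (halt : ∀ x y z : M, x = y ∨ y = z ∨ x = z → T x y z = 0)
    (hB : ∀ a x y z : M, x = y ∨ y = z ∨ x = z → T (T x y a) a z = 0)
    (x i j p q : M) :
    T (T x i j) p q + T (T x i p) j q + T (T x j q) i p + T (T x p q) i j = 0 := by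
  have h := trilinear_polarize T hB x (i + q) j p
  have hi := trilinear_polarize T hB x i j p
  have hq := trilinear_polarize T hB x q j p
  have swap := trilinear_swap_last T halt
  simp only [map_add, LinearMap.add_apply] at h
  rw [swap x q j, swap x q p]
  simp only [map_neg, LinearMap.neg_apply, ← swap (T x q j) i p, ← swap (T x q p) i j]
  linear_combination (norm := abel) h - hi - hq
end

section
/- Let M and T be as in the context. Assume T has the Bruck property and satisfies the associator identity T(T(x,y,z),a,b) = T(T(x,a,b),y,z) + T(x,T(y,a,b),z) + T(x,y,T(z,a,b)) for all x,y,z,a,b ∈ M. Then T(T(T(x,i,a),j,a),p,a) = 0 for all x, i, j, p, a ∈ M. -/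
/-- `Fword T x y l z` is the iterated operation
`F(x,y,[],z) = T x y z`, `F(x,y,a::l,z) = F(T x y a, a, l, z)`,
i.e. the Bruck function `((…((x,y,a₁),a₁,a₂),a₂,…,aₙ),aₙ,z)`. -/
def Fword {M : Type*} (T : M → M → M → M) : M → M → List M → M → M
  | x, y, [], z => T x y z
  | x, y, a :: l, z => Fword T (T x y a) a l z

/-- A `2`-Engel Lie bracket over a module of characteristic `3` is nilpotent of class at most `3`. -/
theorem engel_two_bracket_eq_zero {M : Type*} [AddCommGroup M] [Module (ZMod 3) M]
    (B : M →ₗ[ZMod 3] M →ₗ[ZMod 3] M) (alt : ∀ x, B x x = 0)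
    (engel : ∀ x y, B (B x y) y = 0)
    (leibniz : ∀ x y z, B (B x y) z = B (B x z) y + B x (B y z)) (x y z w : M) :
    B (B (B x y) z) w = 0 := by
  have skew : ∀ u v, B u v = -B v u := fun u v => by
    have h := alt (u + v)
    simp only [map_add, LinearMap.add_apply, alt, zero_add, add_zero] at h
    exact eq_neg_of_add_eq_zero_right h
  have swap : ∀ u v t, B (B u v) t = -B (B u t) v := fun u v t => by
    have h := engel u (v + t)
    simp only [map_add, LinearMap.add_apply, engel, zero_add, add_zero] at h
    exact eq_neg_of_add_eq_zero_right h
  have perm : B (B (B z w) x) y = B (B (B x y) z) w := by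
    rw [swap z w x, skew z x]
    simp only [map_neg, LinearMap.neg_apply, neg_neg]
    rw [swap (B x z) w y, swap x z y]
    simp only [map_neg, LinearMap.neg_apply, neg_neg]
  have product : ∀ u v s t, B (B u v) (B s t) = (2 : ℤ) • B (B (B u v) s) t :=
    fun u v s t => by
      have h := leibniz (B u v) s t
      rw [swap (B u v) t s] at h
      rw [two_smul]
      nth_rewrite 1 [h]
      abel
  have three : (3 : ℤ) • B (B (B x y) z) w = 0 := by
    have h : ((3 : ℤ) : ZMod 3) = 0 := by decide
    rw [← Int.cast_smul_eq_zsmul (ZMod 3), h, zero_smul]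
  have four : (2 : ℤ) • B (B (B x y) z) w = -((2 : ℤ) • B (B (B x y) z) w) := by
    exact (product x y z w).symm.trans ((skew _ _).trans (by rw [product, perm]))
  calc B (B (B x y) z) w
      = (2 : ℤ) • B (B (B x y) z) w + (2 : ℤ) • B (B (B x y) z) w
          - (3 : ℤ) • B (B (B x y) z) w := by abel
    _ = 0 := by rw [three]; nth_rewrite 1 [four]; abel

/-- Let `M` be a vector space over `𝔽₃` and `T` an alternating
trilinear map with the Bruck property satisfying the associator identity.
Then `T (T (T x i a) j a) p a = 0`. -/
theorem stmt_14 (M : Type*) [AddCommGroup M] [Module (ZMod 3) M]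
    (T : M →ₗ[ZMod 3] M →ₗ[ZMod 3] M →ₗ[ZMod 3] M)
    (halt : ∀ x y z : M, x = y ∨ y = z ∨ x = z → T x y z = 0)
    (hBruckAlt : ∀ (l : List M) (x y z : M), x = y ∨ y = z ∨ x = z →
      Fword (fun a b c => T a b c) x y l z = 0)
    (hBruckPerm : ∀ (l l' : List M), l.Perm l' → ∀ x y z : M,
      Fword (fun a b c => T a b c) x y l z = Fword (fun a b c => T a b c) x y l' z)
    (hassoc : ∀ x y z a b : M,
      T (T x y z) a b = T (T x a b) y z + T x (T y a b) z + T x y (T z a b))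
    (x i j p a : M) :
    T (T (T x i a) j a) p a = 0 := by
  have skew : ∀ u v w, T u v w = -T u w v := fun u v w => by
    have h := halt u (v + w) (v + w) (.inr (.inl rfl))
    simp only [map_add, LinearMap.add_apply, halt u v v (.inr (.inl rfl)),
      halt u w w (.inr (.inl rfl)), zero_add, add_zero] at h
    exact eq_neg_of_add_eq_zero_left (by rw [add_comm]; exact h)
  let B : M →ₗ[ZMod 3] M →ₗ[ZMod 3] M :=
    LinearMap.mk₂ (ZMod 3) (fun u v => T u v a) (by simp) (by simp) (by simp) (by simp)
  refine engel_two_bracket_eq_zero B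
    (fun u => halt u u a (.inl rfl)) (fun u v => ?_) (fun u v w => ?_) x i j p
  · change T (T u v a) v a = 0
    rw [skew, neg_eq_zero]
    exact hBruckAlt [a] u v v (.inr (.inl rfl))
  · change T (T u v a) w a = T (T u w a) v a + T u (T v w a) a
    rw [hassoc, halt a w a (.inr (.inr rfl)), map_zero, add_zero]
end

section
/- Let M and T be as in the context. Assume T has the Bruck property and satisfies the associator identity T(T(x,y,z),a,b) = T(T(x,a,b),y,z) + T(x,T(y,a,b),z) + T(x,y,T(z,a,b)) for all x,y,z,a,b ∈ M. Then for all x, i, j, p, a, b, c ∈ M: T(T(T(x,i,a),j,b),p,c) + T(T(T(x,i,a),j,c),p,b) + T(T(T(x,i,b),j,a),p,c) + T(T(T(x,i,b),j,c),p,a) + T(T(T(x,i,c),j,a),p,b) + T(T(T(x,i,c),j,b),p,a) = 0. -/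
section SymmetrizedWords

variable {M : Type*} [AddCommGroup M] [Module (ZMod 3) M]

/-- The word `T (T x y a) z b` symmetrized in `a` and `b`. -/
def symPair (T : M →ₗ[ZMod 3] M →ₗ[ZMod 3] M →ₗ[ZMod 3] M) (x y z a b : M) : M :=
  T (T x y a) z b + T (T x y b) z a

/-- The word `T (T (T x i a) j b) p c` symmetrized in `a`, `b` and `c`. -/
def symTriple (T : M →ₗ[ZMod 3] M →ₗ[ZMod 3] M →ₗ[ZMod 3] M) (x i j p a b c : M) : M :=
  T (T (T x i a) j b) p c + T (T (T x i a) j c) p b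
    + T (T (T x i b) j a) p c + T (T (T x i b) j c) p a
    + T (T (T x i c) j a) p b + T (T (T x i c) j b) p a

variable {T : M →ₗ[ZMod 3] M →ₗ[ZMod 3] M →ₗ[ZMod 3] M}

lemma trilinear_swap_left (halt : ∀ x y z : M, x = y ∨ y = z ∨ x = z → T x y z = 0)
    (x y z : M) : T x y z = -T y x z := by
  have h := halt (x + y) (x + y) z (Or.inl rfl)
  simp only [map_add, LinearMap.add_apply, halt x x z (Or.inl rfl),
    halt y y z (Or.inl rfl), zero_add, add_zero] at h
  exact eq_neg_of_add_eq_zero_right h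

lemma trilinear_swap_right (halt : ∀ x y z : M, x = y ∨ y = z ∨ x = z → T x y z = 0)
    (x y z : M) : T x y z = -T x z y := by
  have h := halt x (y + z) (y + z) (Or.inr (Or.inl rfl))
  simp only [map_add, LinearMap.add_apply, halt x y y (Or.inr (Or.inl rfl)),
    halt x z z (Or.inr (Or.inl rfl)), zero_add, add_zero] at h
  exact eq_neg_of_add_eq_zero_right h

lemma symPair_swap_left (halt : ∀ x y z : M, x = y ∨ y = z ∨ x = z → T x y z = 0)
    (x y z a b : M) : symPair T x y z a b = -symPair T y x z a b := by
  simp only [symPair, trilinear_swap_left halt x y, map_neg, LinearMap.neg_apply]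
  abel

lemma symPair_self_right (halt : ∀ x y z : M, x = y ∨ y = z ∨ x = z → T x y z = 0)
    (hsq : ∀ x y a : M, T (T x y a) a y = 0) (x y a b : M) : symPair T x y y a b = 0 := by
  have h := hsq x y (a + b)
  simp only [map_add, LinearMap.add_apply, hsq, zero_add, add_zero] at h
  rw [symPair, trilinear_swap_right halt (T x y a) y b, trilinear_swap_right halt (T x y b) y a,
    ← neg_add, add_comm, h, neg_zero]

lemma symPair_swap_right (halt : ∀ x y z : M, x = y ∨ y = z ∨ x = z → T x y z = 0)
    (hsq : ∀ x y a : M, T (T x y a) a y = 0) (x y z a b : M) :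
    symPair T x y z a b = -symPair T x z y a b := by
  have hadd : symPair T x (y + z) (y + z) a b = symPair T x y y a b + symPair T x y z a b
      + symPair T x z y a b + symPair T x z z a b := by
    simp only [symPair, map_add, LinearMap.add_apply]
    abel
  rw [symPair_self_right halt hsq, symPair_self_right halt hsq, symPair_self_right halt hsq,
    zero_add, add_zero] at hadd
  exact eq_neg_of_add_eq_zero_left hadd.symm

lemma symPair_rotate (halt : ∀ x y z : M, x = y ∨ y = z ∨ x = z → T x y z = 0)
    (hsq : ∀ x y a : M, T (T x y a) a y = 0) (x y z a b : M) :
    symPair T x y z a b = symPair T y z x a b := by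
  rw [symPair_swap_left halt, symPair_swap_right halt hsq, neg_neg]

lemma symTriple_eq_left (x i j p a b c : M) :
    symTriple T x i j p a b c = T (symPair T x i j a b) p c + T (symPair T x i j a c) p b
      + T (symPair T x i j b c) p a := by
  simp only [symTriple, symPair, map_add, LinearMap.add_apply]
  abel

lemma symTriple_eq_right (x i j p a b c : M) :
    symTriple T x i j p a b c = symPair T (T x i a) j p b c + symPair T (T x i b) j p a c
      + symPair T (T x i c) j p a b := by
  simp only [symTriple, symPair]
  abel

lemma symTriple_swap_left (halt : ∀ x y z : M, x = y ∨ y = z ∨ x = z → T x y z = 0)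
    (x i j p a b c : M) : symTriple T x i j p a b c = -symTriple T i x j p a b c := by
  simp only [symTriple_eq_left, symPair_swap_left halt x i, map_neg, LinearMap.neg_apply]
  abel

lemma symTriple_swap_middle (halt : ∀ x y z : M, x = y ∨ y = z ∨ x = z → T x y z = 0)
    (hsq : ∀ x y a : M, T (T x y a) a y = 0) (x i j p a b c : M) :
    symTriple T x i j p a b c = -symTriple T x j i p a b c := by
  simp only [symTriple_eq_left, symPair_swap_right halt hsq x i j, map_neg, LinearMap.neg_apply]
  abel

lemma symTriple_swap_right (halt : ∀ x y z : M, x = y ∨ y = z ∨ x = z → T x y z = 0)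
    (hsq : ∀ x y a : M, T (T x y a) a y = 0) (x i j p a b c : M) :
    symTriple T x i j p a b c = -symTriple T x i p j a b c := by
  simp only [symTriple_eq_right, symPair_swap_right halt hsq _ j p]
  abel

lemma symTriple_swap_pairs (halt : ∀ x y z : M, x = y ∨ y = z ∨ x = z → T x y z = 0)
    (hsq : ∀ x y a : M, T (T x y a) a y = 0) (x i j p a b c : M) :
    symTriple T x i j p a b c = symTriple T j p x i a b c := by
  rw [symTriple_swap_middle halt hsq x i j p, symTriple_swap_left halt x j i p,
    symTriple_swap_right halt hsq j x i p, symTriple_swap_middle halt hsq j x p i]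
  simp only [neg_neg]

lemma symTriple_eq_rotate (halt : ∀ x y z : M, x = y ∨ y = z ∨ x = z → T x y z = 0)
    (hsq : ∀ x y a : M, T (T x y a) a y = 0) (x i j p a b c : M) :
    symTriple T x i j p a b c = symPair T j p (T x i a) b c + symPair T j p (T x i b) a c
      + symPair T j p (T x i c) a b := by
  rw [symTriple_eq_right]
  simp only [symPair_rotate halt hsq _ j p]

lemma symTriple_swap_pairs_neg (halt : ∀ x y z : M, x = y ∨ y = z ∨ x = z → T x y z = 0)
    (hsq : ∀ x y a : M, T (T x y a) a y = 0) (x i j p a b c : M) :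
    symTriple T x i j p a b c = -symTriple T j p x i a b c := by
  rw [symTriple_eq_rotate halt hsq x i j p, symTriple_eq_rotate halt hsq j p x i]
  simp only [symPair, fun s t u : M => trilinear_swap_left halt (T j p s) (T x i t) u]
  abel

lemma symTriple_eq_zero (halt : ∀ x y z : M, x = y ∨ y = z ∨ x = z → T x y z = 0)
    (hsq : ∀ x y a : M, T (T x y a) a y = 0) (x i j p a b c : M) :
    symTriple T x i j p a b c = 0 := by
  have h : symTriple T x i j p a b c = -symTriple T x i j p a b c := by
    conv_rhs => rw [symTriple_swap_pairs halt hsq]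
    exact symTriple_swap_pairs_neg halt hsq x i j p a b c
  have h2 : (2 : ZMod 3) • symTriple T x i j p a b c = 0 := by
    rw [two_smul]
    exact eq_neg_iff_add_eq_zero.mp h
  have hne : (2 : ZMod 3) ≠ 0 := by decide
  have : Fact (Nat.Prime 3) := ⟨Nat.prime_three⟩
  exact (smul_eq_zero.mp h2).resolve_left hne

end SymmetrizedWords

/-- Let `M` be a vector space over `𝔽₃` and `T` an alternating
trilinear map with the Bruck property satisfying the associator identity.
Then the six-term identity (linearization of `ia.ja.pa = 0`) holds. -/
theorem stmt_15 (M : Type*) [AddCommGroup M] [Module (ZMod 3) M]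
    (T : M →ₗ[ZMod 3] M →ₗ[ZMod 3] M →ₗ[ZMod 3] M)
    (halt : ∀ x y z : M, x = y ∨ y = z ∨ x = z → T x y z = 0)
    (hBruckAlt : ∀ (l : List M) (x y z : M), x = y ∨ y = z ∨ x = z →
      Fword (fun a b c => T a b c) x y l z = 0)
    (hBruckPerm : ∀ (l l' : List M), l.Perm l' → ∀ x y z : M,
      Fword (fun a b c => T a b c) x y l z = Fword (fun a b c => T a b c) x y l' z)
    (hassoc : ∀ x y z a b : M,
      T (T x y z) a b = T (T x a b) y z + T x (T y a b) z + T x y (T z a b))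
    (x i j p a b c : M) :
    T (T (T x i a) j b) p c + T (T (T x i a) j c) p b
      + T (T (T x i b) j a) p c + T (T (T x i b) j c) p a
      + T (T (T x i c) j a) p b + T (T (T x i c) j b) p a = 0 := by
  exact symTriple_eq_zero halt
    (fun u v w => hBruckAlt [w] u v v (Or.inr (Or.inl rfl))) x i j p a b c
end

section
/- Let M and T be as in the context, and assume T satisfies the identity T(T(x,i,j),p,q) + T(T(x,i,p),j,q) + T(T(x,j,q),i,p) + T(T(x,p,q),i,j) = 0 for all x,i,j,p,q ∈ M. Then for all x, a₁, a₂, a₃, a₄ ∈ M and every permutation σ of {1,2,3,4}, the element T(T(x,a_{σ(1)},a_{σ(2)}),a_{σ(3)},a_{σ(4)}) lies in the 𝔽₃-linear span of the four elements T(T(x,a₁,a₂),a₃,a₄), T(T(x,a₁,a₃),a₂,a₄), T(T(x,a₁,a₄),a₂,a₃), T(T(x,a₂,a₃),a₁,a₄). -/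
/-- Let `M` be a vector space over `𝔽₃` and `T` an alternating
trilinear map satisfying the identity (X).  Then every permutation of
`T (T x a₁ a₂) a₃ a₄` lies in the span of four such elements. -/
theorem stmt_16 (M : Type*) [AddCommGroup M] [Module (ZMod 3) M]
    (T : M →ₗ[ZMod 3] M →ₗ[ZMod 3] M →ₗ[ZMod 3] M)
    (halt : ∀ x y z : M, x = y ∨ y = z ∨ x = z → T x y z = 0)
    (hX : ∀ x i j p q : M,
      T (T x i j) p q + T (T x i p) j q + T (T x j q) i p + T (T x p q) i j = 0)
    (x a₁ a₂ a₃ a₄ : M) (σ : Equiv.Perm (Fin 4)) :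
    T (T x (![a₁, a₂, a₃, a₄] (σ 0)) (![a₁, a₂, a₃, a₄] (σ 1)))
        (![a₁, a₂, a₃, a₄] (σ 2)) (![a₁, a₂, a₃, a₄] (σ 3)) ∈
      Submodule.span (ZMod 3)
        ({T (T x a₁ a₂) a₃ a₄, T (T x a₁ a₃) a₂ a₄,
          T (T x a₁ a₄) a₂ a₃, T (T x a₂ a₃) a₁ a₄} : Set M) := by
  have skew (u v w : M) : T u v w = -T u w v := by
    have h := halt u (v + w) (v + w) (by simp)
    simp only [map_add, LinearMap.add_apply, halt u v v (by simp), halt u w w (by simp)] at h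
    exact eq_neg_of_add_eq_zero_right (by simpa using h)
  set S := Submodule.span (ZMod 3)
    ({T (T x a₁ a₂) a₃ a₄, T (T x a₁ a₃) a₂ a₄,
      T (T x a₁ a₄) a₂ a₃, T (T x a₂ a₃) a₁ a₄} : Set M)
  have mem₁₂ : T (T x a₁ a₂) a₃ a₄ ∈ S := Submodule.subset_span (by simp)
  have mem₁₃ : T (T x a₁ a₃) a₂ a₄ ∈ S := Submodule.subset_span (by simp)
  have mem₁₄ : T (T x a₁ a₄) a₂ a₃ ∈ S := Submodule.subset_span (by simp)
  have mem₂₃ : T (T x a₂ a₃) a₁ a₄ ∈ S := Submodule.subset_span (by simp)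
  have mem₃₄ : T (T x a₃ a₄) a₁ a₂ ∈ S := by
    have h := hX x a₁ a₂ a₄ a₃
    rw [skew (T x a₁ a₂) a₄ a₃, skew x a₄ a₃, map_neg, LinearMap.neg_apply,
      LinearMap.neg_apply] at h
    have h' : T (T x a₃ a₄) a₁ a₂
        = T (T x a₁ a₄) a₂ a₃ + T (T x a₂ a₃) a₁ a₄ - T (T x a₁ a₂) a₃ a₄ := by
      rw [← sub_eq_zero, ← neg_eq_zero, ← h]
      abel
    rw [h']
    exact S.sub_mem (S.add_mem mem₁₄ mem₂₃) mem₁₂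
  have mem₂₄ : T (T x a₂ a₄) a₁ a₃ ∈ S := by
    have h' : T (T x a₂ a₄) a₁ a₃
        = -(T (T x a₁ a₂) a₃ a₄ + T (T x a₁ a₃) a₂ a₄ + T (T x a₃ a₄) a₁ a₂) := by
      rw [← sub_eq_zero, ← hX x a₁ a₂ a₃ a₄]
      abel
    rw [h']
    exact S.neg_mem (S.add_mem (S.add_mem mem₁₂ mem₁₃) mem₃₄)
  have swap_left {u v w y : M} (h : T (T x v u) w y ∈ S) : T (T x u v) w y ∈ S := by
    rw [skew x u v, map_neg, LinearMap.neg_apply, LinearMap.neg_apply]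
    exact S.neg_mem h
  have swap_right {u v w y : M} (h : T (T x u v) y w ∈ S) : T (T x u v) w y ∈ S := by
    rw [skew (T x u v) w y]
    exact S.neg_mem h
  have mem_sorted (i j k l : Fin 4) (hij : i < j) (hkl : k < l) (hik : i ≠ k) (hil : i ≠ l)
      (hjk : j ≠ k) (hjl : j ≠ l) :
      T (T x (![a₁, a₂, a₃, a₄] i) (![a₁, a₂, a₃, a₄] j))
        (![a₁, a₂, a₃, a₄] k) (![a₁, a₂, a₃, a₄] l) ∈ S := by
    fin_cases i <;> fin_cases j <;> first | exact absurd hij (by decide) | skip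
    all_goals fin_cases k <;> first | exact absurd rfl hik | exact absurd rfl hjk | skip
    all_goals fin_cases l <;>
      first | exact absurd hkl (by decide) | exact absurd rfl hil | exact absurd rfl hjl | assumption
  have ne {i j : Fin 4} (h : i ≠ j) : σ i ≠ σ j := σ.injective.ne h
  rcases lt_or_gt_of_ne (ne (show (0 : Fin 4) ≠ 1 by decide)) with h₀₁ | h₀₁ <;>
    rcases lt_or_gt_of_ne (ne (show (2 : Fin 4) ≠ 3 by decide)) with h₂₃ | h₂₃
  · exact mem_sorted _ _ _ _ h₀₁ h₂₃ (ne (by decide)) (ne (by decide)) (ne (by decide))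
      (ne (by decide))
  · exact swap_right <| mem_sorted _ _ _ _ h₀₁ h₂₃ (ne (by decide)) (ne (by decide))
      (ne (by decide)) (ne (by decide))
  · exact swap_left <| mem_sorted _ _ _ _ h₀₁ h₂₃ (ne (by decide)) (ne (by decide))
      (ne (by decide)) (ne (by decide))
  · exact swap_left <| swap_right <| mem_sorted _ _ _ _ h₀₁ h₂₃ (ne (by decide))
      (ne (by decide)) (ne (by decide)) (ne (by decide))
end
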